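/- arXiv:math/0304118 — 4 statements merged into one kernel-verified Lean document; each statement's English description precedes it below -/
import Mathlib

section
/- Let (A, m_A) be a Noetherian regular local ring of Krull dimension 2 and let I ⊆ A be an ideal such that A/I has finite length. Let Â denote the m_A-adic completion of A and Î = I·Â. If there exist elements u, v ∈ Â that generate the maximal ideal of Â and an integer j ≥ 1 such that Î = ⟨u, v^j⟩, then I is generated by an A-regular sequence of length two, i.e., I is a complete intersection ideal in A. -/
namespace CurvAux

open IsLocalRing
open scoped Pointwise

/-- A Noetherian local ring whose maximal ideal is generated by one non-nilpotent element is a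
domain. -/
lemma aux_isDomain {B : Type*} [CommRing B] [IsLocalRing B] [IsNoetherianRing B] (y : B)
    (hm : maximalIdeal B = Ideal.span {y}) (hy : ¬ IsNilpotent y) : IsDomain B := by
  have key : ∀ c : B, c ≠ 0 → ∃ (k : ℕ) (w : B), IsUnit w ∧ c = y ^ k * w := by
    intro c hc
    have h1 : ∃ n, ¬ (y ^ n ∣ c) := by
      by_contra! h
      apply hc
      have := Ideal.iInf_pow_eq_bot_of_isLocalRing (maximalIdeal B) (Ideal.IsPrime.ne_top')
      rw [← Ideal.mem_bot, ← this, Submodule.mem_iInf]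
      intro n
      rw [hm, Ideal.span_singleton_pow, Ideal.mem_span_singleton]
      exact h n
    classical
    have hn := Nat.find_spec h1
    have hmin := fun m => Nat.find_min h1 (m := m)
    generalize Nat.find h1 = n at hn hmin
    cases n with
    | zero => simp at hn
    | succ k =>
      have := hmin k (by omega)
      push Not at this
      obtain ⟨w, rfl⟩ := this
      refine ⟨k, w, ?_, rfl⟩
      by_contra hw
      have hw' : w ∈ maximalIdeal B := by simpa using hw
      rw [hm, Ideal.mem_span_singleton] at hw'
      obtain ⟨t, rfl⟩ := hw'
      exact hn ⟨t, by ring⟩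
  have : NoZeroDivisors B := by
    constructor
    intro a b hab
    by_contra! h
    obtain ⟨k, w, hw, rfl⟩ := key a h.1
    obtain ⟨l, z, hz, rfl⟩ := key b h.2
    apply hy
    refine ⟨k + l, ?_⟩
    have h2 : y ^ (k + l) * (w * z) = 0 := by rw [← hab]; ring
    exact (hw.mul hz).mul_left_eq_zero.mp h2
  exact NoZeroDivisors.to_isDomain B

variable {A : Type*} [CommRing A] [IsLocalRing A] [IsNoetherianRing A]

lemma aux_height (hdim : ringKrullDim A = 2) (x : A) (n : ℕ)
    (h : maximalIdeal A ^ n ≤ Ideal.span {x}) (hx : x ∈ maximalIdeal A) : False := by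
  have hmin : maximalIdeal A ∈ (Ideal.span {x}).minimalPrimes := by
    refine ⟨⟨inferInstance, by simpa [Ideal.span_le] using hx⟩, ?_⟩
    rintro q ⟨hq, hxq⟩ -
    exact hq.le_of_pow_le (h.trans hxq)
  have h1 := Ideal.height_le_one_of_isPrincipal_of_mem_minimalPrimes _ _ hmin
  have h2 := IsLocalRing.maximalIdeal_height_eq_ringKrullDim (R := A)
  rw [hdim] at h2
  have h3 : (maximalIdeal A).height = 2 := WithBot.coe_injective h2
  rw [h3] at h1
  exact absurd h1 (by decide)

lemma aux_pow (hdim : ringKrullDim A = 2) (x y : A)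
    (hm : maximalIdeal A = Ideal.span {x, y}) (n : ℕ) : ¬ y ^ n ∈ Ideal.span {x} := by
  intro h
  have hx : x ∈ maximalIdeal A := hm ▸ Ideal.subset_span (by simp)
  have hrad : maximalIdeal A ≤ (Ideal.span {x}).radical := by
    rw [hm, Ideal.span_le]
    rintro z (rfl | rfl)
    · exact Ideal.le_radical (Ideal.mem_span_singleton_self _)
    · exact ⟨n, h⟩
  obtain ⟨k, hk⟩ := Ideal.exists_pow_le_of_le_radical_of_fg hrad
    (IsNoetherian.noetherian _)
  exact aux_height hdim x k hk hx

lemma aux_prime (hdim : ringKrullDim A = 2) (x y : A)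
    (hm : maximalIdeal A = Ideal.span {x, y}) : (Ideal.span {x}).IsPrime := by
  have hx : x ∈ maximalIdeal A := hm ▸ Ideal.subset_span (by simp)
  have hne : Ideal.span {x} ≠ ⊤ := by
    rw [Ne, Ideal.span_singleton_eq_top]; simpa using hx
  have : Nontrivial (A ⧸ Ideal.span {x}) := Ideal.Quotient.nontrivial_iff.mpr hne
  have hloc : IsLocalRing (A ⧸ Ideal.span {x}) :=
    IsLocalRing.of_surjective' (Ideal.Quotient.mk _) Ideal.Quotient.mk_surjective
  rw [← Ideal.Quotient.isDomain_iff_prime]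
  apply aux_isDomain (Ideal.Quotient.mk _ y)
  · have h1 : (maximalIdeal A).map (Ideal.Quotient.mk (Ideal.span {x})) =
        maximalIdeal (A ⧸ Ideal.span {x}) := by
      apply IsLocalRing.eq_maximalIdeal
      apply (Ideal.map_eq_top_or_isMaximal_of_surjective _ Ideal.Quotient.mk_surjective
        inferInstance).resolve_left
      intro h
      have h3 := congrArg (Ideal.comap (Ideal.Quotient.mk (Ideal.span {x}))) h
      rw [Ideal.comap_map_of_surjective _ Ideal.Quotient.mk_surjective, Ideal.comap_top,
        ← RingHom.ker_eq_comap_bot, Ideal.mk_ker, sup_eq_left.mpr] at h3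
      · exact Ideal.IsPrime.ne_top' h3
      · simpa [Ideal.span_le] using hx
    have h0 : Ideal.Quotient.mk (Ideal.span {x}) x = 0 :=
      Ideal.Quotient.eq_zero_iff_mem.mpr (Ideal.mem_span_singleton_self _)
    rw [← h1, hm, Ideal.map_span, Set.image_pair, h0]
    simp
  · rintro ⟨n, hn⟩
    rw [← map_pow, Ideal.Quotient.eq_zero_iff_mem] at hn
    exact aux_pow hdim x y hm n hn

lemma aux_regular_domain (hdim : ringKrullDim A = 2) (x y : A)
    (hm : maximalIdeal A = Ideal.span {x, y}) : IsDomain A := by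
  have hm' : ∀ n : ℕ, maximalIdeal A = Ideal.span {x + y ^ (n + 1), y} := by
    intro n
    rw [hm]
    apply le_antisymm <;> rw [Ideal.span_le] <;> rintro z (rfl | rfl)
    · exact Ideal.mem_span_pair.mpr ⟨1, - y ^ n, by ring⟩
    · exact Ideal.subset_span (by simp)
    · exact Ideal.mem_span_pair.mpr ⟨1, y ^ n, by ring⟩
    · exact Ideal.subset_span (by simp)
  have hp := fun n => aux_prime hdim _ _ (hm' n)
  have hex : ∃ n, Ideal.span {x + y ^ (n + 1)} ∉ minimalPrimes A := by
    by_contra! h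
    have hfin := minimalPrimes.finite_of_isNoetherianRing A
    have hinj : Function.Injective (fun n : ℕ => Ideal.span {x + y ^ (n + 1)}) := by
      have hlt : ∀ n k : ℕ, n < k →
          Ideal.span {x + y ^ (n + 1)} ≠ Ideal.span {x + y ^ (k + 1)} := by
        intro n k hnk he
        obtain ⟨d, rfl⟩ := Nat.exists_eq_add_of_lt hnk
        have h1 : x + y ^ (n + d + 1 + 1) ∈ Ideal.span {x + y ^ (n + 1)} :=
          he ▸ Ideal.mem_span_singleton_self _
        have h2 := Ideal.sub_mem _ (Ideal.mem_span_singleton_self (x + y ^ (n + 1))) h1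
        have h3 : (x + y ^ (n + 1)) - (x + y ^ (n + d + 1 + 1))
            = y ^ (n + 1) * (1 - y ^ (d + 1)) := by ring
        rw [h3] at h2
        have hy : y ∈ maximalIdeal A := hm ▸ Ideal.subset_span (by simp)
        have hu : IsUnit (1 - y ^ (d + 1)) := by
          apply IsLocalRing.isUnit_one_sub_self_of_mem_nonunits
          exact Ideal.pow_mem_of_mem _ hy _ (Nat.succ_pos d)
        exact aux_pow hdim _ y (hm' n) (n + 1) ((Ideal.mul_unit_mem_iff_mem _ hu).mp h2)
      intro n k he
      rcases lt_trichotomy n k with h | h | h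
      · exact absurd he (hlt _ _ h)
      · exact h
      · exact absurd he.symm (hlt _ _ h)
    exact Set.infinite_of_injective_forall_mem hinj h hfin
  obtain ⟨n, hn⟩ := hex
  set z := x + y ^ (n + 1) with hz
  have hzp := hp n
  obtain ⟨P, hP, hPz⟩ := Ideal.exists_minimalPrimes_le (I := ⊥) (J := Ideal.span {z}) bot_le
  have hPp : P.IsPrime := hP.1.1
  have hzP : z ∉ P := by
    intro h
    apply hn
    have : P = Ideal.span {z} := le_antisymm hPz (by simpa [Ideal.span_le] using h)
    exact this ▸ hP
  have hzm : z ∈ maximalIdeal A := (hm' n) ▸ Ideal.subset_span (by simp [hz])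
  have hPbot : P = ⊥ := by
    apply Submodule.eq_bot_of_le_smul_of_le_jacobson_bot (maximalIdeal A) P
      (IsNoetherian.noetherian _) _ (IsLocalRing.maximalIdeal_le_jacobson _)
    intro p hp
    obtain ⟨q, rfl⟩ := Ideal.mem_span_singleton.mp (hPz hp)
    exact Submodule.smul_mem_smul hzm ((hPp.mem_or_mem hp).resolve_left hzP)
  rw [hPbot] at hPp
  exact IsDomain.of_bot_isPrime A

lemma aux_ci (hdim : ringKrullDim A = 2) (x y : A)
    (hm : maximalIdeal A = Ideal.span {x, y}) (a b : A)
    (hne : Ideal.span {a, b} ≠ ⊤) (N : ℕ) (hN : maximalIdeal A ^ N ≤ Ideal.span {a, b}) :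
    RingTheory.Sequence.IsRegular A [a, b] := by
  have hdom := aux_regular_domain hdim x y hm
  have hxp := aux_prime hdim x y hm
  have hxy : y ∉ Ideal.span {x} := by simpa using aux_pow hdim x y hm 1
  have hx0 : x ≠ 0 := by
    rintro rfl
    apply aux_height hdim y 1 (by simp [hm]) (by simp [hm])
  have ha : a ≠ 0 := by
    rintro rfl
    refine aux_height hdim b N (hN.trans (by simp)) ?_
    exact IsLocalRing.le_maximalIdeal hne (Ideal.subset_span (by simp))
  -- b is regular modulo a
  have hb : ∀ c, b * c ∈ Ideal.span {a} → c ∈ Ideal.span {a} := by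
    intro c hbc
    by_contra hc
    have hex : ∃ n, ∀ r ∈ maximalIdeal A ^ n, r * c ∈ Ideal.span {a} := by
      refine ⟨N, fun r hr => ?_⟩
      obtain ⟨s, t, rfl⟩ := Ideal.mem_span_pair.mp (hN hr)
      have : (s * a + t * b) * c = (s * c) * a + t * (b * c) := by ring
      rw [this]
      exact Ideal.add_mem _ (Ideal.mul_mem_left _ _ (Ideal.mem_span_singleton_self _))
        (Ideal.mul_mem_left _ _ hbc)
    classical
    have hn := Nat.find_spec hex
    have hmin := fun m => Nat.find_min hex (m := m)
    generalize Nat.find hex = n at hn hmin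
    cases n with
    | zero => exact hc (by simpa using hn 1 (by simp))
    | succ k =>
      have := hmin k (by omega)
      push Not at this
      obtain ⟨r, hr, hrc⟩ := this
      have hz : ∀ z ∈ maximalIdeal A, z * (r * c) ∈ Ideal.span {a} := by
        intro z hz
        rw [← mul_assoc]
        apply hn
        rw [pow_succ']
        exact Ideal.mul_mem_mul hz hr
      obtain ⟨s, hs⟩ := Ideal.mem_span_singleton.mp (hz x (hm ▸ Ideal.subset_span (by simp)))
      obtain ⟨t, ht⟩ := Ideal.mem_span_singleton.mp (hz y (hm ▸ Ideal.subset_span (by simp)))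
      have h1 : y * s = x * t := by
        apply mul_left_cancel₀ ha
        linear_combination x * ht - y * hs
      have h2 : y * s ∈ Ideal.span {x} := Ideal.mem_span_singleton.mpr ⟨t, h1⟩
      obtain ⟨s', rfl⟩ := Ideal.mem_span_singleton.mp ((hxp.mem_or_mem h2).resolve_left hxy)
      apply hrc
      apply Ideal.mem_span_singleton.mpr ⟨s', _⟩
      apply mul_left_cancel₀ hx0
      linear_combination hs
  refine ⟨?_, ?_⟩
  · rw [RingTheory.Sequence.isWeaklyRegular_cons_iff,
      RingTheory.Sequence.isWeaklyRegular_cons_iff]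
    refine ⟨?_, ?_, RingTheory.Sequence.IsWeaklyRegular.nil _ _⟩
    · intro p q hpq
      exact mul_left_cancel₀ ha (by simpa using hpq)
    · rw [isSMulRegular_iff_right_eq_zero_of_smul]
      intro c hc
      obtain ⟨c, rfl⟩ := Submodule.mkQ_surjective _ c
      rw [← map_smul] at hc
      rw [Submodule.mkQ_apply, Submodule.Quotient.mk_eq_zero] at hc ⊢
      have he : (a • ⊤ : Submodule A A) = Ideal.span {a} := by
        rw [← Submodule.ideal_span_singleton_smul]; simp
      rw [he] at hc ⊢
      exact hb c (by simpa using hc)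
  · intro h
    apply hne
    rw [eq_comm]
    rw [smul_eq_mul, Ideal.mul_top] at h
    rw [h]
    rw [Ideal.ofList_cons, Ideal.ofList_singleton, Ideal.span_insert]

lemma aux_gen (I : Ideal A) (N : ℕ) (hN : maximalIdeal A ^ N ≤ I)
    (u w : AdicCompletion (maximalIdeal A) A)
    (h : I.map (algebraMap A (AdicCompletion (maximalIdeal A) A)) = Ideal.span {u, w}) :
    ∃ a b : A, I = Ideal.span {a, b} := by
  let π := (AdicCompletion.evalₐ (maximalIdeal A) (N + 1)).toRingHom
  have hπ : π.comp (algebraMap A (AdicCompletion (maximalIdeal A) A)) =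
      Ideal.Quotient.mk (maximalIdeal A ^ (N + 1)) :=
    (AdicCompletion.evalₐ (maximalIdeal A) (N + 1)).comp_algebraMap
  obtain ⟨a, ha⟩ := Ideal.Quotient.mk_surjective (π u)
  obtain ⟨b, hb⟩ := Ideal.Quotient.mk_surjective (π w)
  have h1 : I.map (Ideal.Quotient.mk (maximalIdeal A ^ (N + 1))) =
      (Ideal.span {a, b}).map (Ideal.Quotient.mk (maximalIdeal A ^ (N + 1))) := by
    rw [← hπ, ← Ideal.map_map, h, Ideal.map_span, hπ, Ideal.map_span, Set.image_pair,
      Set.image_pair, ha, hb]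
  have h2 := congrArg (Ideal.comap (Ideal.Quotient.mk (maximalIdeal A ^ (N + 1)))) h1
  rw [Ideal.comap_map_of_surjective _ Ideal.Quotient.mk_surjective,
    Ideal.comap_map_of_surjective _ Ideal.Quotient.mk_surjective,
    ← RingHom.ker_eq_comap_bot, Ideal.mk_ker,
    sup_eq_left.mpr ((Ideal.pow_le_pow_right (Nat.le_succ N)).trans hN)] at h2
  refine ⟨a, b, le_antisymm ?_ (h2 ▸ le_sup_left)⟩
  apply Submodule.le_of_le_smul_of_le_jacobson_bot (IsNoetherian.noetherian I)
    (IsLocalRing.maximalIdeal_le_jacobson _)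
  refine h2.le.trans (sup_le_sup_left ?_ _)
  rw [pow_succ']
  exact Ideal.mul_mono_right hN

end CurvAux

theorem curvilinear_implies_complete_intersection
    (A : Type) [CommRing A] [IsLocalRing A] [IsNoetherianRing A]
    -- A is regular of dimension 2:
    (hdim : ringKrullDim A = 2)
    (hreg : ∃ x y : A, IsLocalRing.maximalIdeal A = Ideal.span {x, y})
    (I : Ideal A)
    -- A/I has finite length:
    (hlen : IsFiniteLength A (A ⧸ I))
    -- curvilinear hypothesis in the completion Â of A at its maximal ideal:
    (hcurvi : ∃ (u v : AdicCompletion (IsLocalRing.maximalIdeal A) A) (j : ℕ), 1 ≤ j ∧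
      (Ideal.span {u, v}).IsMaximal ∧
      I.map (algebraMap A (AdicCompletion (IsLocalRing.maximalIdeal A) A)) =
        Ideal.span {u, v ^ j}) :
    -- conclusion: I is a complete intersection ideal in A
    ∃ x y : A, I = Ideal.span {x, y} ∧ RingTheory.Sequence.IsRegular A [x, y] := by
  obtain ⟨x, y, hm⟩ := hreg
  obtain ⟨u, v, j, hj, hmax, hI⟩ := hcurvi
  have hart : IsArtinianRing (A ⧸ I) := by
    have := (isFiniteLength_iff_isNoetherian_isArtinian.mp hlen).2
    exact isArtinian_of_tower A this
  obtain ⟨N, hN⟩ := IsLocalRing.exists_maximalIdeal_pow_le_of_isArtinianRing_quotient I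
  obtain ⟨a, b, rfl⟩ := CurvAux.aux_gen I N hN u (v ^ j) hI
  refine ⟨a, b, rfl, CurvAux.aux_ci hdim x y hm a b ?_ N hN⟩
  intro htop
  rw [htop, Ideal.map_top] at hI
  apply hmax.ne_top
  rw [eq_top_iff, hI, Ideal.span_le]
  rintro z (rfl | rfl)
  · exact Ideal.subset_span (by simp)
  · exact Ideal.pow_mem_of_mem _ (Ideal.subset_span (by simp)) _ hj
end

section
/- Let k be an algebraically closed field, S = k[x,y,z], and let a, b, c ∈ S be homogeneous of the same degree m generating an ideal I = ⟨a,b,c⟩ of height 2, so that Z = V(I) ⊂ P² is a finite set. Suppose all base points of I are curvilinear: for every minimal prime P over I, writing (S_P)^ for the completion of the localization S_P at its maximal ideal, there exist u, v generating the maximal ideal of (S_P)^ and an integer j ≥ 1 with I·(S_P)^ = ⟨u, v^j⟩. Then every syzygy (A,B,C) ∈ S³ with A·a + B·b + C·c = 0 and A, B, C ∈ I^sat lies in the Koszul module K, the submodule of S³ generated by (b,−a,0), (c,0,−a), (0,c,−b). -/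
/-!
STATEMENT 1 (Cox): Let k be algebraically closed, S = k[x,y,z], and a, b, c ∈ S
homogeneous of the same degree m generating an ideal I of height 2.  If all base
points of I are curvilinear, then every syzygy (A,B,C) on (a,b,c) with
A, B, C ∈ I^sat lies in the Koszul module K = ⟨(b,−a,0), (c,0,−a), (0,c,−b)⟩.
-/

open MvPolynomial

noncomputable section

/-- Height of an ideal: infimum of the heights of the primes containing it. -/
def idealHeight {A : Type*} [CommRing A] (I : Ideal A) : ℕ∞ :=
  ⨅ (P : PrimeSpectrum A) (_ : I ≤ P.asIdeal), Order.height P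

/-- Saturation of an ideal `I` with respect to the ideal `b`. -/
def Ideal.sat {A : Type*} [CommRing A] (b I : Ideal A) : Set A :=
  { x | ∃ j : ℕ, ∀ y ∈ b ^ j, y * x ∈ I }

/-- Explicit form of membership in the Koszul module. -/
def InKoszul {S : Type*} [CommRing S] (a b c A B C : S) : Prop :=
  ∃ p q r : S, A = p * b + q * c ∧ B = -(p * a) + r * c ∧ C = -(q * a) - r * b

theorem koszul_mem_iff {S : Type*} [CommRing S] (a b c A B C : S) :
    ![A, B, C] ∈ Submodule.span S {![b, -a, 0], ![c, 0, -a], ![0, c, -b]} ↔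
      InKoszul a b c A B C := by
  rw [Submodule.mem_span_triple]
  constructor
  · rintro ⟨p, q, r, h⟩
    have h0 := congrFun h 0
    have h1 := congrFun h 1
    have h2 := congrFun h 2
    simp at h0 h1 h2
    exact ⟨p, q, r, h0.symm, h1.symm, by rw [← h2]; ring⟩
  · rintro ⟨p, q, r, rfl, rfl, rfl⟩
    refine ⟨p, q, r, ?_⟩
    ext i
    fin_cases i <;> simp <;> ring

/-- In a UFD, the kernel of the second Koszul map is spanned by `(c,-b,a)`. -/
theorem koszul_exact {S : Type*} [CommRing S] [IsDomain S] [UniqueFactorizationMonoid S]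
    (a b c p q r : S) (hcop : ∀ d, d ∣ a → d ∣ b → d ∣ c → IsUnit d)
    (h1 : p * b + q * c = 0) (h2 : -(p * a) + r * c = 0) (h3 : -(q * a) - r * b = 0) :
    ∃ s, p = s * c ∧ q = -(s * b) ∧ r = s * a := by
  classical
  have key : ∀ d e : S, d ∣ e * a → d ∣ e * b → d ∣ e * c → d ∣ e := by
    intro d e ha hb hc
    let _ : NormalizedGCDMonoid S := Classical.choice inferInstance
    have h := dvd_gcd ha (dvd_gcd hb hc)
    have hu : IsUnit (gcd a (gcd b c)) := hcop _ (gcd_dvd_left _ _)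
      ((gcd_dvd_right _ _).trans (gcd_dvd_left _ _)) ((gcd_dvd_right _ _).trans (gcd_dvd_right _ _))
    have h' : gcd (e * a) (gcd (e * b) (e * c)) ∣ e * gcd a (gcd b c) :=
      ((gcd_mul_left' e b c).gcd (Associated.refl (e * a)) |> fun _ => by
        have h1 := gcd_mul_left' e b c
        have h2 := (Associated.refl (e * a)).gcd h1
        exact (h2.trans (gcd_mul_left' e a _)).dvd)
    exact (hu.dvd_mul_right).1 (h.trans h')
  by_cases ha : a = 0
  · by_cases hb : b = 0
    · by_cases hc : c = 0
      · subst ha hb hc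
        have := hcop 0 dvd_rfl dvd_rfl dvd_rfl
        exact absurd this not_isUnit_zero
      · obtain ⟨s, hs⟩ := key c p ⟨r, by linear_combination -h2⟩ ⟨-q, by linear_combination h1⟩
          ⟨p, by ring⟩
        refine ⟨s, by rw [hs]; ring, ?_, ?_⟩
        · apply mul_left_cancel₀ hc
          linear_combination h1 - b * hs
        · apply mul_left_cancel₀ hc
          linear_combination h2 + a * hs
    · obtain ⟨s, hs⟩ := key b q ⟨-r, by linear_combination -h3⟩ ⟨q, by ring⟩
          ⟨-p, by linear_combination h1⟩
      refine ⟨-s, ?_, by rw [hs]; ring, ?_⟩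
      · apply mul_left_cancel₀ hb
        linear_combination h1 - c * hs
      · apply mul_left_cancel₀ hb
        linear_combination -h3 - a * hs
  · obtain ⟨s, hs⟩ := key a r ⟨r, by ring⟩ ⟨-q, by linear_combination -h3⟩
          ⟨p, by linear_combination h2⟩
    refine ⟨s, ?_, ?_, by rw [hs]; ring⟩
    · apply mul_left_cancel₀ ha
      linear_combination -h2 + c * hs
    · apply mul_left_cancel₀ ha
      linear_combination -h3 - b * hs

/-- The Koszul module has depth at least two with respect to a regular sequence `f, g, h`. -/
theorem koszul_depth {S : Type*} [CommRing S] [IsDomain S] [UniqueFactorizationMonoid S]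
    (a b c A B C : S) (hcop : ∀ d, d ∣ a → d ∣ b → d ∣ c → IsUnit d)
    (f g h : S) (hf : f ≠ 0) (hfg : ∀ s, f ∣ g * s → f ∣ s)
    (hfgh : ∀ s, h * s ∈ Ideal.span {f, g} → s ∈ Ideal.span {f, g})
    (H1 : InKoszul a b c (f * A) (f * B) (f * C)) (H2 : InKoszul a b c (g * A) (g * B) (g * C))
    (H3 : InKoszul a b c (h * A) (h * B) (h * C)) : InKoszul a b c A B C := by
  obtain ⟨p1, p2, p3, hp1, hp2, hp3⟩ := H1
  obtain ⟨q1, q2, q3, hq1, hq2, hq3⟩ := H2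
  obtain ⟨r1, r2, r3, hr1, hr2, hr3⟩ := H3
  obtain ⟨s, hs1, hs2, hs3⟩ := koszul_exact a b c (f * q1 - g * p1) (f * q2 - g * p2)
    (f * q3 - g * p3) hcop (by linear_combination g * hp1 - f * hq1)
    (by linear_combination g * hp2 - f * hq2) (by linear_combination g * hp3 - f * hq3)
  obtain ⟨t, ht1, ht2, ht3⟩ := koszul_exact a b c (f * r1 - h * p1) (f * r2 - h * p2)
    (f * r3 - h * p3) hcop (by linear_combination h * hp1 - f * hr1)
    (by linear_combination h * hp2 - f * hr2) (by linear_combination h * hp3 - f * hr3)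
  obtain ⟨l, hl1, hl2, hl3⟩ := koszul_exact a b c (g * r1 - h * q1) (g * r2 - h * q2)
    (g * r3 - h * q3) hcop (by linear_combination h * hq1 - g * hr1)
    (by linear_combination h * hq2 - g * hr2) (by linear_combination h * hq3 - g * hr3)
  have hrel : h * s - g * t + f * l = 0 := by
    have e1 : (h * s - g * t + f * l) * c = 0 := by
      linear_combination -h * hs1 + g * ht1 - f * hl1
    have e2 : (h * s - g * t + f * l) * b = 0 := by
      linear_combination h * hs2 - g * ht2 + f * hl2
    have e3 : (h * s - g * t + f * l) * a = 0 := by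
      linear_combination -h * hs3 + g * ht3 - f * hl3
    by_contra hne
    have hc0 := (mul_eq_zero.1 e1).resolve_left hne
    have hb0 := (mul_eq_zero.1 e2).resolve_left hne
    have ha0 := (mul_eq_zero.1 e3).resolve_left hne
    exact not_isUnit_zero (hcop 0 (by rw [ha0]) (by rw [hb0]) (by rw [hc0]))
  have hs := hfgh s (Ideal.mem_span_pair.2 ⟨-l, t, by linear_combination -hrel⟩)
  obtain ⟨α, β', hαβ⟩ := Ideal.mem_span_pair.1 hs
  obtain ⟨γ, hγ⟩ := hfg (t - h * β') ⟨h * α + l, by linear_combination -hrel - h * hαβ⟩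
  -- cancel the correction terms
  have cancel : ∀ e P Q R, f * Q - g * P = s * e → f * R - h * P = t * e →
      ∃ π, P + β' * e = f * π := by
    intro e P Q R h1 h2
    obtain ⟨π, hπ⟩ := hfg (P + β' * e) ⟨Q - α * e, by linear_combination -h1 + e * hαβ⟩
    exact ⟨π, hπ⟩
  obtain ⟨π1, hπ1⟩ := cancel c p1 q1 r1 hs1 ht1
  obtain ⟨π2, hπ2⟩ := cancel (-b) p2 q2 r2 (by linear_combination hs2) (by linear_combination ht2)
  obtain ⟨π3, hπ3⟩ := cancel a p3 q3 r3 hs3 ht3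
  refine ⟨π1, π2, π3, ?_, ?_, ?_⟩
  · apply mul_left_cancel₀ hf
    linear_combination hp1 + b * hπ1 + c * hπ2
  · apply mul_left_cancel₀ hf
    linear_combination hp2 - a * hπ1 + c * hπ3
  · apply mul_left_cancel₀ hf
    linear_combination hp3 - a * hπ2 - b * hπ3

/-- Local triviality of syzygies with coefficients in `I` if `I` is locally generated by `a, b`. -/
theorem koszul_local {S : Type*} [CommRing S] [IsDomain S] [UniqueFactorizationMonoid S]
    (a b c A B C : S) (hcop : ∀ d, d ∣ a → d ∣ b → d ∣ c → IsUnit d)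
    (P : Ideal S) [P.IsPrime] (hsyz : A * a + B * b + C * c = 0)
    (s : S) (hs : s ∉ P) (α β : S) (hsc : s * c = α * a + β * b)
    (s' : S) (hs' : s' ∉ P) (hC : s' * C ∈ Ideal.span {a, b, c}) :
    ∃ w, w ∉ P ∧ InKoszul a b c (w * A) (w * B) (w * C) := by
  have hs0 : s ≠ 0 := fun h => hs (h ▸ P.zero_mem)
  have hab : ∃ a' b' g : S, IsRelPrime a' b' ∧ g * a' = a ∧ g * b' = b ∧ ¬ (a = 0 ∧ b = 0) := by
    by_cases ha : a = 0
    · by_cases hb : b = 0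
      · exfalso
        have : c = 0 := by
          rw [ha, hb] at hsc
          simpa [hs0] using hsc
        subst ha hb this
        exact not_isUnit_zero (hcop 0 dvd_rfl dvd_rfl dvd_rfl)
      · obtain ⟨b', a', g, h, h1, h2⟩ := UniqueFactorizationMonoid.exists_reduced_factors b hb a
        exact ⟨a', b', g, h.symm, h2, h1, fun h => hb h.2⟩
    · obtain ⟨a', b', g, h, h1, h2⟩ := UniqueFactorizationMonoid.exists_reduced_factors a ha b
      exact ⟨a', b', g, h, h1, h2, fun h => ha h.1⟩
  obtain ⟨a', b', g, hrel, hga, hgb, hnz⟩ := hab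
  have hg0 : g ≠ 0 := by
    rintro rfl
    exact hnz ⟨by simpa using hga.symm, by simpa using hgb.symm⟩
  have hgP : g ∉ P := by
    intro hgP
    obtain ⟨g0, hg0P, hg0p, hg0d⟩ : ∃ g0 ∈ P, Prime g0 ∧ g0 ∣ g := by
      have hprod := UniqueFactorizationMonoid.factors_prod hg0
      have hm : (UniqueFactorizationMonoid.factors g).prod ∈ P := by
        obtain ⟨u, hu⟩ := hprod
        have : (UniqueFactorizationMonoid.factors g).prod = g * ↑(u⁻¹) := by
          exact (Units.eq_mul_inv_iff_mul_eq u).2 hu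
        rw [this]
        exact P.mul_mem_right _ hgP
      obtain ⟨x, hx, hxP⟩ := (Ideal.IsPrime.multiset_prod_mem_iff_exists_mem ‹_› _).1 hm
      exact ⟨x, hxP, UniqueFactorizationMonoid.prime_of_factor _ hx,
        UniqueFactorizationMonoid.dvd_of_mem_factors hx⟩
    have hda : g0 ∣ a := hg0d.trans ⟨a', hga.symm⟩
    have hdb : g0 ∣ b := hg0d.trans ⟨b', hgb.symm⟩
    have hdc : g0 ∣ s * c := by
      rw [hsc]; exact dvd_add (hda.mul_left _) (hdb.mul_left _)
    rcases hg0p.dvd_or_dvd hdc with h | h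
    · exact hs (P.mem_of_dvd h hg0P)
    · exact hg0p.not_isUnit (hcop g0 hda hdb h)
  -- the reduced syzygy
  have h0 : (s * A + α * C) * a' + (s * B + β * C) * b' = 0 := by
    apply mul_left_cancel₀ hg0
    linear_combination s * hsyz + (s * A + α * C) * hga + (s * B + β * C) * hgb - C * hsc
  obtain ⟨t, ht1, ht2⟩ : ∃ t, s * A + α * C = t * b' ∧ s * B + β * C = -(t * a') := by
    by_cases hb' : b' = 0
    · have hu : IsUnit a' := hrel dvd_rfl (by rw [hb']; exact dvd_zero _)
      obtain ⟨u, hu'⟩ := hu.exists_right_inv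
      refine ⟨-(s * B + β * C) * u, ?_, by linear_combination -(s * B + β * C) * hu'⟩
      have : (s * A + α * C) * a' = 0 := by simpa [hb'] using h0
      rw [hb', mul_zero]
      exact (mul_eq_zero.1 this).resolve_right hu.ne_zero
    · obtain ⟨t, ht⟩ := hrel.symm.dvd_of_dvd_mul_right
        (show b' ∣ (s * A + α * C) * a' from ⟨-(s * B + β * C), by linear_combination h0⟩)
      refine ⟨t, by rw [ht]; ring, ?_⟩
      apply mul_left_cancel₀ hb'
      linear_combination h0 - a' * ht
  obtain ⟨p, q, r, hpqr⟩ := Submodule.mem_span_triple.1 hC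
  simp only [smul_eq_mul] at hpqr
  -- combine the denominators
  refine ⟨g * s * (s * s'), ?_, ?_⟩
  · exact fun h => (by
      rcases Ideal.IsPrime.mem_or_mem ‹_› h with h | h
      · rcases Ideal.IsPrime.mem_or_mem ‹_› h with h | h
        · exact hgP h
        · exact hs h
      · rcases Ideal.IsPrime.mem_or_mem ‹_› h with h | h
        · exact hs h
        · exact hs' h)
  · have hx : s * s' * C = (s * p + r * α) * a + (s * q + r * β) * b := by
      linear_combination -s * hpqr + r * hsc
    generalize s * p + r * α = x at hx
    generalize s * q + r * β = y at hx
    refine ⟨s * s' * t + g * (x * β - y * α), -(g * x * s), -(g * y * s), ?_, ?_, ?_⟩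
    · linear_combination (s * s' * g) * ht1 + (s * s' * t) * hgb - g * α * hx + g * x * hsc
    · linear_combination (s * s' * g) * ht2 - (s * s' * t) * hga - g * β * hx + g * y * hsc
    · linear_combination g * s * hx

theorem InKoszul.swap23 {S : Type*} [CommRing S] {a b c A B C : S} (h : InKoszul a b c A B C) :
    InKoszul a c b A C B := by
  obtain ⟨p, q, r, h1, h2, h3⟩ := h
  exact ⟨q, p, -r, by rw [h1]; ring, by rw [h3]; ring, by rw [h2]; ring⟩

theorem InKoszul.rot {S : Type*} [CommRing S] {a b c A B C : S} (h : InKoszul a b c A B C) :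
    InKoszul c a b C A B := by
  obtain ⟨p, q, r, h1, h2, h3⟩ := h
  exact ⟨-q, -r, p, by rw [h3]; ring, by rw [h1]; ring, by rw [h2]; ring⟩

/-- In a local ring, if `(a,b,c)` is generated by two elements, one generator is redundant. -/
theorem local_two_of_three {R : Type*} [CommRing R] [IsLocalRing R] (a b c u w : R)
    (h : Ideal.span {a, b, c} = Ideal.span {u, w}) :
    c ∈ Ideal.span {a, b} ∨ b ∈ Ideal.span {a, c} ∨ a ∈ Ideal.span {b, c} := by
  classical
  have hmem : ∀ y ∈ Ideal.span {a, b, c}, ∃ e f, e * u + f * w = y := by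
    intro y hy; rw [h] at hy; exact Ideal.mem_span_pair.1 hy
  have ha : a ∈ Ideal.span {a, b, c} := Ideal.subset_span (by simp)
  have hb : b ∈ Ideal.span {a, b, c} := Ideal.subset_span (by simp)
  have hc : c ∈ Ideal.span {a, b, c} := Ideal.subset_span (by simp)
  obtain ⟨a1, a2, ha'⟩ := hmem a ha
  obtain ⟨b1, b2, hb'⟩ := hmem b hb
  obtain ⟨c1, c2, hc'⟩ := hmem c hc
  have hu : u ∈ Ideal.span {a, b, c} := by rw [h]; exact Ideal.subset_span (by simp)
  have hw : w ∈ Ideal.span {a, b, c} := by rw [h]; exact Ideal.subset_span (by simp)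
  let ρ := IsLocalRing.residue R
  obtain ⟨v, hv0, hv⟩ := (Matrix.exists_vecMul_eq_zero_iff
    (M := !![ρ a1, ρ a2, 0; ρ b1, ρ b2, 0; ρ c1, ρ c2, 0])).2 (by simp [Matrix.det_fin_three])
  have hv1 := congrFun hv 0
  have hv2 := congrFun hv 1
  simp [Matrix.vecMul, dotProduct, Fin.sum_univ_three] at hv1 hv2
  obtain ⟨x, hx⟩ := IsLocalRing.residue_surjective (v 0)
  obtain ⟨y, hy⟩ := IsLocalRing.residue_surjective (v 1)
  obtain ⟨z, hz⟩ := IsLocalRing.residue_surjective (v 2)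
  have hm : ∀ r : R, ρ r = 0 ↔ r ∈ IsLocalRing.maximalIdeal R := fun r =>
    IsLocalRing.residue_eq_zero_iff r
  have m1 : x * a1 + y * b1 + z * c1 ∈ IsLocalRing.maximalIdeal R := by
    rw [← hm]; simpa [ρ, hx, hy, hz] using hv1
  have m2 : x * a2 + y * b2 + z * c2 ∈ IsLocalRing.maximalIdeal R := by
    rw [← hm]; simpa [ρ, hx, hy, hz] using hv2
  have hsum : x * a + y * b + z * c ∈
      IsLocalRing.maximalIdeal R • Ideal.span {a, b, c} := by
    have : x * a + y * b + z * c = (x * a1 + y * b1 + z * c1) • u +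
        (x * a2 + y * b2 + z * c2) • w := by
      simp only [smul_eq_mul]
      linear_combination -x * ha' - y * hb' - z * hc'
    rw [this]
    exact add_mem (Submodule.smul_mem_smul m1 hu) (Submodule.smul_mem_smul m2 hw)
  have nak : ∀ N : Ideal R, Ideal.span {a, b, c} ≤
      N ⊔ IsLocalRing.maximalIdeal R • Ideal.span {a, b, c} → Ideal.span {a, b, c} ≤ N := by
    intro N hN
    refine Submodule.le_of_le_smul_of_le_jacobson_bot ?_
      (IsLocalRing.maximalIdeal_le_jacobson _) hN
    exact ⟨{a, b, c}, by simp⟩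
  have one : ∀ (e a b c x y z : R) (J : Ideal R), e * x = 1 → x * a + y * b + z * c ∈ J →
      a ∈ Ideal.span {b, c} ⊔ J := by
    intro e a b c x y z J he hJ
    refine Submodule.mem_sup.2 ⟨-(e * y) * b + -(e * z) * c, Ideal.mem_span_pair.2 ⟨_, _, rfl⟩,
      e * (x * a + y * b + z * c), J.mul_mem_left _ hJ, by linear_combination a * he⟩
  have unit : ∀ r, ρ r ≠ 0 → ∃ e, e * r = 1 := by
    intro r hr
    have : IsUnit r := (IsLocalRing.residue_ne_zero_iff_isUnit r).1 hr
    exact this.exists_left_inv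
  have hcase : v 0 ≠ 0 ∨ v 1 ≠ 0 ∨ v 2 ≠ 0 := by
    by_contra! hcon
    apply hv0
    ext i
    fin_cases i
    · exact hcon.1
    · exact hcon.2.1
    · exact hcon.2.2
  have gen : ∀ N : Ideal R, ∀ p ∈ N, ∀ q ∈ N, ∀ J, p ∈ N ⊔ J ∧ q ∈ N ⊔ J := fun N p hp q hq J =>
    ⟨Submodule.mem_sup_left hp, Submodule.mem_sup_left hq⟩
  rcases hcase with h0 | h0 | h0
  · obtain ⟨e, he⟩ := unit x (by rw [← hx] at h0; exact h0)
    right; right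
    refine nak (Ideal.span {b, c}) ?_ ha
    rw [Ideal.span_le]
    rintro t (rfl | rfl | rfl)
    · exact one e _ b c x y z _ he hsum
    · exact Submodule.mem_sup_left (Ideal.subset_span (by simp))
    · exact Submodule.mem_sup_left (Ideal.subset_span (by simp))
  · obtain ⟨e, he⟩ := unit y (by rw [← hy] at h0; exact h0)
    right; left
    refine nak (Ideal.span {a, c}) ?_ hb
    rw [Ideal.span_le]
    rintro t (rfl | rfl | rfl)
    · exact Submodule.mem_sup_left (Ideal.subset_span (by simp))
    · exact one e _ a c y x z _ he (by convert hsum using 1; ring)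
    · exact Submodule.mem_sup_left (Ideal.subset_span (by simp))
  · obtain ⟨e, he⟩ := unit z (by rw [← hz] at h0; exact h0)
    left
    refine nak (Ideal.span {a, b}) ?_ hc
    rw [Ideal.span_le]
    rintro t (rfl | rfl | rfl)
    · exact Submodule.mem_sup_left (Ideal.subset_span (by simp))
    · exact Submodule.mem_sup_left (Ideal.subset_span (by simp))
    · exact one e _ a b z x y _ he (by convert hsum using 1; ring)

/-- If an ideal primary to the maximal ideal becomes two-generated in the completion, then it is
two-generated. -/
theorem two_gen_of_completion {R : Type*} [CommRing R] [IsLocalRing R] [IsNoetherianRing R]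
    (I M : Ideal R) (hM : M = IsLocalRing.maximalIdeal R) (hrad : I.radical = M)
    (u w : AdicCompletion M R)
    (h : I.map (algebraMap R (AdicCompletion M R)) =
      Ideal.span {u, w}) :
    ∃ u0 w0 : R, I = Ideal.span {u0, w0} := by
  obtain ⟨n, hn⟩ := Ideal.exists_radical_pow_le_of_fg I (IsNoetherian.noetherian _)
  rw [hrad] at hn
  let ev := AdicCompletion.evalₐ M (n + 1)
  obtain ⟨u0, hu0⟩ := Ideal.Quotient.mk_surjective (ev u)
  obtain ⟨w0, hw0⟩ := Ideal.Quotient.mk_surjective (ev w)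
  have hmap : I.map (Ideal.Quotient.mk (M ^ (n + 1))) =
      (Ideal.span {u0, w0}).map (Ideal.Quotient.mk (M ^ (n + 1))) := by
    have h1 := congrArg (Ideal.map ev.toRingHom) h
    rw [Ideal.map_map, Ideal.map_span, Set.image_pair] at h1
    rw [Ideal.map_span, Set.image_pair, hu0, hw0]
    have h2 : (ev.toRingHom.comp
        (algebraMap R (AdicCompletion M R))) =
        Ideal.Quotient.mk (M ^ (n + 1)) := by
      ext r
      exact ev.commutes r
    rw [h2] at h1
    exact h1
  have hsup : I ⊔ M ^ (n + 1) = Ideal.span {u0, w0} ⊔ M ^ (n + 1) := by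
    have := congrArg (Ideal.comap (Ideal.Quotient.mk (M ^ (n + 1)))) hmap
    simpa [Ideal.comap_map_of_surjective _ Ideal.Quotient.mk_surjective,
      ← RingHom.ker_eq_comap_bot, Ideal.mk_ker] using this
  have hle : M ^ (n + 1) ≤ M • I := by
    rw [pow_succ', smul_eq_mul]
    exact Ideal.mul_mono_right hn
  refine ⟨u0, w0, le_antisymm ?_ ?_⟩
  · refine Submodule.le_of_le_smul_of_le_jacobson_bot (IsNoetherian.noetherian _)
      (hM ▸ IsLocalRing.maximalIdeal_le_jacobson _) ?_
    calc I ≤ I ⊔ M ^ (n + 1) := le_sup_left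
      _ = _ := hsup
      _ ≤ _ := sup_le_sup_left hle _
  · calc _ ≤ _ := le_sup_left
      _ = I ⊔ M ^ (n + 1) := hsup.symm
      _ ≤ I := sup_le le_rfl (hle.trans Submodule.smul_le_right)

section poly

variable {k : Type} [Field k] (x : Fin 3 → k)

/-- Partial evaluation of the first two variables. -/
def peval2 : MvPolynomial (Fin 3) k →ₐ[k] MvPolynomial (Fin 3) k :=
  aeval ![C (x 0), C (x 1), X 2]

/-- Partial evaluation of the first variable. -/
def peval1 : MvPolynomial (Fin 3) k →ₐ[k] MvPolynomial (Fin 3) k :=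
  aeval ![C (x 0), X 1, X 2]

theorem ker_peval2 : RingHom.ker (peval2 x) = Ideal.span {X 0 - C (x 0), X 1 - C (x 1)} := by
  apply le_antisymm
  · intro p hp
    set J : Ideal (MvPolynomial (Fin 3) k) := Ideal.span {X 0 - C (x 0), X 1 - C (x 1)}
    have h : (Ideal.Quotient.mkₐ k J).comp (peval2 x) = Ideal.Quotient.mkₐ k J := by
      ext i
      fin_cases i
      · simp [peval2]
        symm
        rw [Ideal.Quotient.eq]
        exact Ideal.subset_span (by simp)
      · simp [peval2]
        symm
        rw [Ideal.Quotient.eq]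
        exact Ideal.subset_span (by simp)
      · simp [peval2]
    have := congrArg (fun f => f p) h
    rw [RingHom.mem_ker] at hp
    simp [hp] at this
    exact Ideal.Quotient.eq_zero_iff_mem.1 this.symm
  · rw [Ideal.span_le]
    rintro t (rfl | rfl) <;> simp [peval2, RingHom.mem_ker]

theorem ker_peval1 : RingHom.ker (peval1 x) = Ideal.span {X 0 - C (x 0)} := by
  apply le_antisymm
  · intro p hp
    set J : Ideal (MvPolynomial (Fin 3) k) := Ideal.span {X 0 - C (x 0)}
    have h : (Ideal.Quotient.mkₐ k J).comp (peval1 x) = Ideal.Quotient.mkₐ k J := by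
      ext i
      fin_cases i
      · simp [peval1]
        symm
        rw [Ideal.Quotient.eq]
        exact Ideal.subset_span (by simp)
      · simp [peval1]
      · simp [peval1]
    have := congrArg (fun f => f p) h
    rw [RingHom.mem_ker] at hp
    simp [hp] at this
    exact Ideal.Quotient.eq_zero_iff_mem.1 this.symm
  · rw [Ideal.span_le]
    rintro t rfl
    simp [peval1, RingHom.mem_ker]

theorem X_sub_C_ne_zero' (i : Fin 3) (r : k) : (X i - C r : MvPolynomial (Fin 3) k) ≠ 0 := by
  intro h
  have := congrArg (eval (fun _ => r + 1)) h
  simp at this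

theorem peval1_X1 : X 1 - C (x 1) ∉ RingHom.ker (peval1 x) := by
  rw [RingHom.mem_ker]
  simpa [peval1] using X_sub_C_ne_zero' 1 (x 1)

theorem peval2_X2 : X 2 - C (x 2) ∉ RingHom.ker (peval2 x) := by
  rw [RingHom.mem_ker]
  simpa [peval2] using X_sub_C_ne_zero' 2 (x 2)

theorem height_gt_two (P : Ideal (MvPolynomial (Fin 3) k)) [P.IsPrime]
    (h : ∀ i, X i ∈ P) : ¬ P.height ≤ (2 : ℕ) := by
  intro hP
  have h2 : (RingHom.ker (peval2 (0 : Fin 3 → k))).IsPrime := RingHom.ker_isPrime _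
  have h1 : (RingHom.ker (peval1 (0 : Fin 3 → k))).IsPrime := RingHom.ker_isPrime _
  have l2 : RingHom.ker (peval2 (0 : Fin 3 → k)) < P := by
    refine lt_of_le_of_ne ?_ ?_
    · rw [ker_peval2, Ideal.span_le]
      rintro t (rfl | rfl) <;> simp [h]
    · intro e
      apply peval2_X2 (0 : Fin 3 → k)
      rw [e]
      simp [h]
  have l1 : RingHom.ker (peval1 (0 : Fin 3 → k)) < RingHom.ker (peval2 (0 : Fin 3 → k)) := by
    refine lt_of_le_of_ne ?_ ?_
    · rw [ker_peval1, ker_peval2]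
      exact Ideal.span_mono (by simp)
    · intro e
      apply peval1_X1 (0 : Fin 3 → k)
      rw [e, ker_peval2]
      exact Ideal.subset_span (by simp)
  have l0 : ⊥ < RingHom.ker (peval1 (0 : Fin 3 → k)) := by
    rw [bot_lt_iff_ne_bot, ker_peval1]
    simpa using X_sub_C_ne_zero' (0 : Fin 3) (0 : k)
  have e2 := Ideal.height_add_one_le_of_lt_of_isPrime l2
  have e1 := Ideal.height_add_one_le_of_lt_of_isPrime l1
  have e0 := Ideal.height_add_one_le_of_lt_of_isPrime l0
  generalize (RingHom.ker (peval1 (0 : Fin 3 → k))).height = n1 at *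
  generalize (RingHom.ker (peval2 (0 : Fin 3 → k))).height = n2 at *
  generalize P.height = n3 at *
  have : (3 : ℕ∞) ≤ 2 := by
    calc (3 : ℕ∞) = 0 + 1 + 1 + 1 := by norm_num
      _ ≤ (⊥ : Ideal (MvPolynomial (Fin 3) k)).height + 1 + 1 + 1 := by gcongr; exact zero_le
      _ ≤ n1 + 1 + 1 := by gcongr
      _ ≤ n2 + 1 := by gcongr
      _ ≤ n3 := e2
      _ ≤ 2 := hP
  exact absurd this (by decide)

end poly

theorem curvilinear_base_points_syzygy_is_koszul
    (k : Type) [Field k] [IsAlgClosed k]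
    (a b c : MvPolynomial (Fin 3) k) (m : ℕ)
    (ha : a.IsHomogeneous m) (hb : b.IsHomogeneous m) (hc : c.IsHomogeneous m)
    (I : Ideal (MvPolynomial (Fin 3) k)) (hI : I = Ideal.span {a, b, c})
    (hht : idealHeight I = 2)
    -- all base points of I are curvilinear:
    (hcurvi : ∀ (P : Ideal (MvPolynomial (Fin 3) k)) (hP : P ∈ I.minimalPrimes),
      letI : P.IsPrime := hP.1.1
      ∃ (u v : AdicCompletion
          (IsLocalRing.maximalIdeal (Localization.AtPrime P)) (Localization.AtPrime P))
        (j : ℕ), 1 ≤ j ∧ (Ideal.span {u, v}).IsMaximal ∧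
        I.map ((algebraMap (Localization.AtPrime P)
            (AdicCompletion (IsLocalRing.maximalIdeal (Localization.AtPrime P))
              (Localization.AtPrime P))).comp
          (algebraMap (MvPolynomial (Fin 3) k) (Localization.AtPrime P))) =
          Ideal.span {u, v ^ j}) :
    -- every syzygy vanishing at the base points is a Koszul syzygy:
    ∀ A B C : MvPolynomial (Fin 3) k,
      A * a + B * b + C * c = 0 →
      A ∈ Ideal.sat (Ideal.span {X 0, X 1, X 2}) I →
      B ∈ Ideal.sat (Ideal.span {X 0, X 1, X 2}) I →
      C ∈ Ideal.sat (Ideal.span {X 0, X 1, X 2}) I →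
      ![A, B, C] ∈ Submodule.span (MvPolynomial (Fin 3) k)
        {![b, -a, 0], ![c, 0, -a], ![0, c, -b]} := by
  intro A B C hsyz hA hB hC
  -- heights
  have hge : ∀ Q : Ideal (MvPolynomial (Fin 3) k), Q.IsPrime → I ≤ Q → 2 ≤ Q.height := by
    intro Q hQ hIQ
    have h1 : idealHeight I ≤ Order.height (⟨Q, hQ⟩ : PrimeSpectrum (MvPolynomial (Fin 3) k)) :=
      iInf₂_le (⟨Q, hQ⟩ : PrimeSpectrum (MvPolynomial (Fin 3) k)) hIQ
    rw [hht] at h1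
    exact h1.trans_eq (PrimeSpectrum.height_eq_orderHeight ⟨Q, hQ⟩).symm
  have hcop : ∀ d, d ∣ a → d ∣ b → d ∣ c → IsUnit d := by
    intro d hda hdb hdc
    by_contra hd
    obtain ⟨p, hp⟩ := (Ideal.span {d}).nonempty_minimalPrimes (by simpa)
    have h1 := Ideal.height_le_one_of_isPrincipal_of_mem_minimalPrimes (Ideal.span {d}) _ hp
    have h2 := hge p hp.1.1 (by
      refine le_trans ?_ hp.1.2
      rw [hI, Ideal.span_le]
      rintro t (rfl | rfl | rfl)
      · exact Ideal.mem_span_singleton.2 hda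
      · exact Ideal.mem_span_singleton.2 hdb
      · exact Ideal.mem_span_singleton.2 hdc)
    exact absurd (h2.trans h1) (by decide)
  -- local statement at the minimal primes
  have hloc : ∀ P ∈ I.minimalPrimes, ∃ w, w ∉ P ∧ InKoszul a b c (w * A) (w * B) (w * C) := by
    intro P hP
    have hPp : P.IsPrime := hP.1.1
    obtain ⟨u, v, j, -, -, huv⟩ := hcurvi P hP
    rw [← Ideal.map_map] at huv
    have hrad : (I.map (algebraMap _ (Localization.AtPrime P))).radical =
        IsLocalRing.maximalIdeal (Localization.AtPrime P) := by
      rw [IsLocalization.AtPrime.radical_map_of_mem_minimalPrimes _ P I hP,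
        IsLocalization.AtPrime.map_eq_maximalIdeal P (Localization.AtPrime P)]
    have : IsNoetherianRing (Localization.AtPrime P) :=
      IsLocalization.isNoetherianRing P.primeCompl _ inferInstance
    obtain ⟨u0, w0, h0⟩ := two_gen_of_completion _ _ rfl hrad _ _ huv
    have hPm : IsLocalRing.maximalIdeal (Localization.AtPrime P) ∈
        (Ideal.span {u0, w0}).minimalPrimes := by
      rw [← h0, ← Ideal.radical_minimalPrimes, hrad]
      refine ⟨⟨inferInstance, le_rfl⟩, fun q hq _ => hq.2⟩
    have hht2 : P.height ≤ (2 : ℕ) := by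
      have h1 := Ideal.height_le_card_of_mem_minimalPrimes_span (Set.toFinite _) hPm
      have h2 := IsLocalization.AtPrime.ringKrullDim_eq_height P (Localization.AtPrime P)
      rw [← IsLocalRing.maximalIdeal_height_eq_ringKrullDim] at h2
      rw [← WithBot.coe_inj.1 h2]
      refine h1.trans ?_
      exact_mod_cast (Set.ncard_insert_le u0 {w0}).trans (by simp)
    -- saturation elements lie in I locally
    have hsat : ∀ F ∈ Ideal.sat (Ideal.span {X 0, X 1, X 2}) I, ∃ s, s ∉ P ∧ s * F ∈ I := by
      rintro F ⟨n, hn⟩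
      obtain ⟨i, hi⟩ : ∃ i, (X i : MvPolynomial (Fin 3) k) ∉ P := by
        by_contra! hcon
        exact height_gt_two P hcon hht2
      refine ⟨X i ^ n, fun h => hi (hPp.mem_of_pow_mem n h), hn _ (Ideal.pow_mem_pow ?_ n)⟩
      apply Ideal.subset_span
      fin_cases i <;> simp
    have hred : ∀ d e f : MvPolynomial (Fin 3) k,
        algebraMap _ (Localization.AtPrime P) f ∈ Ideal.span
          {algebraMap _ (Localization.AtPrime P) d, algebraMap _ (Localization.AtPrime P) e} →
        ∃ s, s ∉ P ∧ ∃ α β, s * f = α * d + β * e := by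
      intro d e f h
      rw [← Set.image_pair, ← Ideal.map_span,
        IsLocalization.algebraMap_mem_map_algebraMap_iff P.primeCompl] at h
      obtain ⟨s, hs, h⟩ := h
      obtain ⟨α, β, h⟩ := Ideal.mem_span_pair.1 h
      exact ⟨s, hs, α, β, h.symm⟩
    have h3 : Ideal.span {algebraMap _ (Localization.AtPrime P) a,
        algebraMap _ (Localization.AtPrime P) b, algebraMap _ (Localization.AtPrime P) c} =
        Ideal.span {u0, w0} := by
      rw [← h0, hI, Ideal.map_span]
      simp [Set.image_insert_eq]
    rcases local_two_of_three _ _ _ _ _ h3 with h | h | h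
    · obtain ⟨s, hs, α, β, e⟩ := hred _ _ _ h
      obtain ⟨s', hs', e'⟩ := hsat C hC
      exact koszul_local a b c A B C hcop P hsyz s hs α β e s' hs' (hI ▸ e')
    · obtain ⟨s, hs, α, β, e⟩ := hred _ _ _ h
      obtain ⟨s', hs', e'⟩ := hsat B hB
      obtain ⟨w, hw, hk⟩ := koszul_local a c b A C B (fun d h1 h2 h3 => hcop d h1 h3 h2) P
        (by linear_combination hsyz) s hs α β e s' hs' (by
          rw [hI] at e'
          rwa [Set.pair_comm c b])
      exact ⟨w, hw, hk.swap23⟩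
    · obtain ⟨s, hs, α, β, e⟩ := hred _ _ _ h
      obtain ⟨s', hs', e'⟩ := hsat A hA
      obtain ⟨w, hw, hk⟩ := koszul_local b c a B C A (fun d h1 h2 h3 => hcop d h3 h1 h2) P
        (by linear_combination hsyz) s hs α β e s' hs' (by
          rw [hI] at e'
          rwa [Set.pair_comm c a, Set.insert_comm b a])
      exact ⟨w, hw, hk.rot⟩
  -- globalization
  set K := Submodule.span (MvPolynomial (Fin 3) k)
        {![b, -a, 0], ![c, 0, -a], ![0, c, -b]} with hK
  have hsm : ∀ (r : MvPolynomial (Fin 3) k) (D E F : MvPolynomial (Fin 3) k),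
      r • ![D, E, F] ∈ K ↔ InKoszul a b c (r * D) (r * E) (r * F) := by
    intro r D E F
    rw [← koszul_mem_iff]
    simp [hK]
  by_contra hnot
  have hne : K.mkQ ![A, B, C] ≠ 0 := by
    rwa [Ne, Submodule.mkQ_apply, Submodule.Quotient.mk_eq_zero]
  obtain ⟨Q, hQ, hle⟩ := exists_le_isAssociatedPrime_of_isNoetherianRing
    (MvPolynomial (Fin 3) k) _ hne
  obtain ⟨hQp, y, hy⟩ := Submodule.isAssociatedPrime_iff.1 hQ
  have hann : ∀ r, InKoszul a b c (r * A) (r * B) (r * C) → r ∈ Q := by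
    intro r hr
    apply hle
    rw [Submodule.mem_colon_singleton, Submodule.mem_bot, ← map_smul, Submodule.mkQ_apply,
      Submodule.Quotient.mk_eq_zero]
    exact (hsm r A B C).2 hr
  have hIQ : I ≤ Q := by
    rw [hI, Ideal.span_le]
    rintro t (rfl | rfl | rfl)
    · exact hann _ ⟨-B, -C, 0, by linear_combination hsyz, by ring, by ring⟩
    · exact hann _ ⟨A, 0, -C, by ring, by linear_combination hsyz, by ring⟩
    · exact hann _ ⟨0, A, B, by ring, by ring, by linear_combination hsyz⟩
  obtain ⟨P, hP, hPQ⟩ := Ideal.exists_minimalPrimes_le hIQ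
  have hPp : P.IsPrime := hP.1.1
  obtain ⟨w, hwP, hw⟩ := hloc P hP
  have hlt : P < Q := lt_of_le_of_ne hPQ fun e => hwP (e ▸ hann w hw)
  have hdim : ringKrullDim (MvPolynomial (Fin 3) k) = 3 := by
    rw [MvPolynomial.ringKrullDim_of_isNoetherianRing]
    simp
  have hmax : Q.IsMaximal := by
    obtain ⟨N, hN, hQN⟩ := Q.exists_le_maximal hQp.ne_top
    have hNp := hN.isPrime
    by_cases e : Q = N
    · rwa [e]
    · exfalso
      have e1 := Ideal.height_add_one_le_of_lt_of_isPrime hlt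
      have e2 := Ideal.height_add_one_le_of_lt_of_isPrime (lt_of_le_of_ne hQN e)
      have e3 := hge P hPp hP.1.2
      have e4 : (N.height : WithBot ℕ∞) ≤ (3 : ℕ∞) := by
        have := Ideal.height_le_ringKrullDim_of_isPrime (I := N)
        rw [hdim] at this
        exact this
      have e5 := WithBot.coe_le_coe.1 e4
      have : (4 : ℕ∞) ≤ 3 := by
        calc (4 : ℕ∞) = 2 + 1 + 1 := by norm_num
          _ ≤ P.height + 1 + 1 := by gcongr
          _ ≤ Q.height + 1 := by gcongr
          _ ≤ N.height := e2
          _ ≤ 3 := e5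
      exact absurd this (by decide)
  obtain ⟨x, hx⟩ := MvPolynomial.isMaximal_iff_eq_vanishingIdeal_singleton.1 hmax
  have hXQ : ∀ i, X i - MvPolynomial.C (x i) ∈ Q := by
    intro i
    rw [hx, MvPolynomial.mem_vanishingIdeal_singleton_iff]
    simp
  obtain ⟨y, rfl⟩ := K.mkQ_surjective y
  have hyQ : ∀ r, r ∈ Q ↔ r • y ∈ K := by
    intro r
    rw [hy, Submodule.mem_colon_singleton, Submodule.mem_bot, ← map_smul, Submodule.mkQ_apply,
      Submodule.Quotient.mk_eq_zero]
  have hyy : y = ![y 0, y 1, y 2] := by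
    ext i
    fin_cases i <;> rfl
  have hin : ∀ r ∈ Q, InKoszul a b c (r * y 0) (r * y 1) (r * y 2) := by
    intro r hr
    rw [← hsm, ← hyy]
    exact (hyQ r).1 hr
  have hker1 : (RingHom.ker (peval1 x)).IsPrime := RingHom.ker_isPrime _
  have hker2 : (RingHom.ker (peval2 x)).IsPrime := RingHom.ker_isPrime _
  have hfin := koszul_depth a b c (y 0) (y 1) (y 2) hcop (X 0 - MvPolynomial.C (x 0)) (X 1 - MvPolynomial.C (x 1))
    (X 2 - MvPolynomial.C (x 2)) (X_sub_C_ne_zero' _ _)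
    (fun s hs => by
      rw [← Ideal.mem_span_singleton, ← ker_peval1] at hs ⊢
      exact (hker1.mem_or_mem hs).resolve_left (peval1_X1 x))
    (fun s hs => by
      rw [← ker_peval2] at hs ⊢
      exact (hker2.mem_or_mem hs).resolve_left (peval2_X2 x))
    (hin _ (hXQ 0)) (hin _ (hXQ 1)) (hin _ (hXQ 2))
  apply hQp.ne_top
  rw [Ideal.eq_top_iff_one, hyQ, one_smul, hyy]
  exact (koszul_mem_iff a b c _ _ _).2 hfin

end
end

section
/- Let k be a field, S = k[x,y,z], and let f1, f2, f3 ∈ S be homogeneous polynomials generating an ideal I = ⟨f1,f2,f3⟩ of height 2. Then the module V of syzygies on f1, f2, f3 vanishing at the base points equals the Koszul module K if and only if I is a local complete intersection, i.e., for every minimal prime P over I the extended ideal I·S_P in the localization S_P is generated by an S_P-regular sequence of length two. -/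
/-!
STATEMENT 2 (Cox–Schenck): Let k be a field, S = k[x,y,z], and f1, f2, f3 ∈ S
homogeneous generating an ideal I = ⟨f1,f2,f3⟩ of height 2.  Then the module V
of syzygies on f1, f2, f3 vanishing at the base points equals the Koszul module
K if and only if I is a local complete intersection (at every minimal prime P
over I, I·S_P is generated by an S_P-regular sequence of length two).
-/

open MvPolynomial

noncomputable section

def RP {R : Type*} [CommRing R] (x y : R) : Prop := x ≠ 0 ∧ ∀ v, x ∣ y * v → x ∣ v

theorem span_insert_of_mem {R : Type*} [CommRing R] {x y z : R} (h : x ∈ Ideal.span {y, z}) :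
    Ideal.span {x, y, z} = Ideal.span {y, z} := Submodule.span_insert_eq_span h

theorem RP.syz {R : Type*} [CommRing R] [IsDomain R] {x y : R} (h : RP x y) {u v : R}
    (e : u * x + v * y = 0) : ∃ t, u = -t * y ∧ v = t * x := by
  obtain ⟨t, ht⟩ := h.2 v ⟨-u, by linear_combination e⟩
  refine ⟨t, ?_, by rw [ht]; ring⟩
  apply mul_right_cancel₀ h.1
  rw [ht] at e
  linear_combination e

theorem RP.symm {R : Type*} [CommRing R] [IsDomain R] {x y : R} (h : RP x y) (hy : y ≠ 0) :
    RP y x := by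
  refine ⟨hy, ?_⟩
  rintro v ⟨w, hw⟩
  obtain ⟨t, h1, h2⟩ := h.syz (u := v) (v := -w) (by linear_combination hw)
  exact ⟨-t, by linear_combination h1⟩

theorem depth_three {R : Type*} [CommRing R] [IsDomain R] {a b p1 p2 p3 s : R} (hab : RP a b)
    (hp : RP p1 p2) (hp3 : ∀ t, p3 * t ∈ Ideal.span {p1, p2} → t ∈ Ideal.span {p1, p2})
    (h1 : s * p1 ∈ Ideal.span {a, b}) (h2 : s * p2 ∈ Ideal.span {a, b})
    (h3 : s * p3 ∈ Ideal.span {a, b}) : s ∈ Ideal.span {a, b} := by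
  rw [Ideal.mem_span_pair] at *
  obtain ⟨e1, f1, h1⟩ := h1
  obtain ⟨e2, f2, h2⟩ := h2
  obtain ⟨e3, f3, h3⟩ := h3
  obtain ⟨t12, g1, g2⟩ := hab.syz (u := p2 * e1 - p1 * e2) (v := p2 * f1 - p1 * f2)
    (by linear_combination p2 * h1 - p1 * h2)
  obtain ⟨t23, -, g4⟩ := hab.syz (u := p3 * e2 - p2 * e3) (v := p3 * f2 - p2 * f3)
    (by linear_combination p3 * h2 - p2 * h3)
  obtain ⟨t31, -, g6⟩ := hab.syz (u := p1 * e3 - p3 * e1) (v := p1 * f3 - p3 * f1)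
    (by linear_combination p1 * h3 - p3 * h1)
  have hc : p3 * t12 = -t23 * p1 + -t31 * p2 := by
    apply mul_right_cancel₀ hab.1
    linear_combination (-p3) * g2 - p1 * g4 - p2 * g6
  have := hp3 t12 (by rw [Ideal.mem_span_pair]; exact ⟨_, _, hc.symm⟩)
  rw [Ideal.mem_span_pair] at this
  obtain ⟨α, β, ht⟩ := this
  obtain ⟨w', hw'⟩ := hp.2 (f1 - β * a) ⟨f2 + α * a, by rw [← ht] at g2; linear_combination g2⟩
  obtain ⟨w, hw⟩ := hp.2 (e1 + β * b) ⟨e2 - α * b, by rw [← ht] at g1; linear_combination g1⟩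
  refine ⟨w, w', ?_⟩
  apply mul_right_cancel₀ hp.1
  linear_combination h1 - a * hw - b * hw'

theorem socle_mem {R : Type*} [CommRing R] [IsDomain R] {a b p q α β γ δ s : R} (hab : RP a b)
    (hp : RP p q) (ha : a = α * p + β * q) (hb : b = γ * p + δ * q)
    (h1 : s * p ∈ Ideal.span {a, b}) (h2 : s * q ∈ Ideal.span {a, b}) :
    ∃ t, s - t * (α * δ - β * γ) ∈ Ideal.span {a, b} := by
  rw [Ideal.mem_span_pair] at *
  obtain ⟨e, f, h1⟩ := h1
  obtain ⟨g, h, h2⟩ := h2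
  obtain ⟨t, g1, g2⟩ := hab.syz (u := q * e - p * g) (v := q * f - p * h)
    (by linear_combination q * h1 - p * h2)
  obtain ⟨w, hw⟩ := hp.2 (e + t * δ) ⟨g - t * γ, by linear_combination g1 - t * hb⟩
  obtain ⟨w', hw'⟩ := hp.2 (f - t * β) ⟨h + t * α, by linear_combination g2 + t * ha⟩
  refine ⟨-t, ?_⟩
  rw [Ideal.mem_span_pair]
  refine ⟨w, w', ?_⟩
  apply mul_right_cancel₀ hp.1
  linear_combination h1 - a * hw - b * hw' + t * δ * ha - t * β * hb

theorem span_det {R : Type*} [CommRing R] {a b p q α β γ δ r : R}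
    (ha : a = α * p + β * q) (hb : b = γ * p + δ * q) (hr : r ∈ Ideal.span {p, q}) :
    r * (α * δ - β * γ) ∈ Ideal.span {a, b} := by
  rw [Ideal.mem_span_pair] at *
  obtain ⟨u, v, rfl⟩ := hr
  exact ⟨u * δ - v * γ, v * α - u * β, by rw [ha, hb]; ring⟩

/-- uniqueness of the socle -/
theorem socle_unique {R : Type*} [CommRing R] [IsDomain R] [IsLocalRing R] {a b p q s s' : R}
    (hab : RP a b) (hp : RP p q) (hm : IsLocalRing.maximalIdeal R = Ideal.span {p, q})
    (ha : a ∈ IsLocalRing.maximalIdeal R) (hb : b ∈ IsLocalRing.maximalIdeal R)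
    (hs : ∀ r ∈ IsLocalRing.maximalIdeal R, s * r ∈ Ideal.span {a, b})
    (hs0 : s ∉ Ideal.span {a, b})
    (hs' : ∀ r ∈ IsLocalRing.maximalIdeal R, s' * r ∈ Ideal.span {a, b}) :
    ∃ t, s' - t * s ∈ Ideal.span {a, b} := by
  have hpm : p ∈ IsLocalRing.maximalIdeal R := hm ▸ Ideal.subset_span (by simp)
  have hqm : q ∈ IsLocalRing.maximalIdeal R := hm ▸ Ideal.subset_span (by simp)
  rw [hm, Ideal.mem_span_pair] at ha hb
  obtain ⟨α, β, ha⟩ := ha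
  obtain ⟨γ, δ, hb⟩ := hb
  obtain ⟨t, ht⟩ := socle_mem hab hp ha.symm hb.symm (hs p hpm) (hs q hqm)
  obtain ⟨t', ht'⟩ := socle_mem hab hp ha.symm hb.symm (hs' p hpm) (hs' q hqm)
  have htu : IsUnit t := by
    by_contra hu
    apply hs0
    have h1 : t ∈ Ideal.span {p, q} := hm ▸ (IsLocalRing.mem_maximalIdeal t).2 hu
    have := Ideal.add_mem _ ht (span_det ha.symm hb.symm h1)
    simpa using this
  obtain ⟨u, rfl⟩ := htu
  refine ⟨t' * ↑u⁻¹, ?_⟩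
  have := Ideal.sub_mem _ ht' (Ideal.mul_mem_left _ (t' * ↑u⁻¹) ht)
  convert this using 1
  have h1 : (u⁻¹ : Rˣ) * (u : R) = 1 := u.inv_mul
  linear_combination (-t' * (α * δ - β * γ)) * h1

theorem exists_socle {R : Type*} [CommRing R] [IsLocalRing R] {J : Ideal R}
    {n : ℕ} {c : R} (hc : c ∉ J) (hn : ∀ y ∈ IsLocalRing.maximalIdeal R ^ n, c * y ∈ J) :
    ∃ r, r * c ∉ J ∧ ∀ y ∈ IsLocalRing.maximalIdeal R, (r * c) * y ∈ J := by
  induction n generalizing c with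
  | zero => exact absurd (by simpa using hn 1 (by simp)) hc
  | succ n ih =>
    by_cases h : ∀ y ∈ IsLocalRing.maximalIdeal R, c * y ∈ J
    · exact ⟨1, by simpa using hc, by simpa using h⟩
    · push Not at h
      obtain ⟨y, hy, hcy⟩ := h
      obtain ⟨r, h1, h2⟩ := ih hcy (fun z hz => by
        rw [mul_assoc]
        exact hn _ (by rw [pow_succ']; exact Ideal.mul_mem_mul hy hz))
      refine ⟨r * y, ?_, fun z hz => ?_⟩
      · rwa [mul_assoc, mul_comm y]
      · have := h2 z hz
        rwa [mul_comm c y, ← mul_assoc] at this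

theorem RP.of_le {R : Type*} [CommRing R] [IsDomain R] {a b x y : R} (hab : RP a b)
    (ha : a ∈ Ideal.span {x, y}) (hb : b ∈ Ideal.span {x, y}) (hx : ¬ IsUnit x) (hy : ¬ IsUnit y) : RP x y := by
  rw [Ideal.mem_span_pair] at ha hb
  obtain ⟨α, β, ha⟩ := ha
  obtain ⟨γ, δ, hb⟩ := hb
  have hx0 : x ≠ 0 := by
    rintro rfl
    apply hy
    have ha' : a = β * y := by linear_combination -ha
    have hb' : b = δ * y := by linear_combination -hb
    obtain ⟨t, h1, h2⟩ := hab.syz (u := δ) (v := -β) (by rw [ha', hb']; ring)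
    have h3 : a * (1 + t * y) = 0 := by linear_combination ha' - y * h2
    rcases mul_eq_zero.1 h3 with h | h
    · exact absurd h hab.1
    · exact IsUnit.of_mul_eq_one (-t) (by linear_combination -h)
  refine ⟨hx0, ?_⟩
  rintro z ⟨w, hw⟩
  obtain ⟨t, h1, h2⟩ := hab.syz (u := γ * z + δ * w) (v := -(α * z + β * w)) (by
    apply mul_right_cancel₀ hx0
    rw [← ha, ← hb]
    linear_combination (δ * (α * x + β * y) - β * (γ * x + δ * y)) * (-hw))
  refine ⟨-t, ?_⟩
  apply mul_right_cancel₀ hab.1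
  linear_combination (-z) * ha + β * hw - x * h2

/-- cyclic case with lengths -/
theorem two_gen_aux {R : Type*} [CommRing R] [IsDomain R] [IsLocalRing R] [IsNoetherianRing R]
    {a b c p q s A0 B0 : R} {n : ℕ}
    (hab : RP a b) (hp : RP p q) (hm : IsLocalRing.maximalIdeal R = Ideal.span {p, q})
    (ha : a ∈ IsLocalRing.maximalIdeal R) (hb : b ∈ IsLocalRing.maximalIdeal R)
    (hc : c ∈ IsLocalRing.maximalIdeal R)
    (hn : IsLocalRing.maximalIdeal R ^ n ≤ Ideal.span {a, b})
    (hfin : Module.length R (R ⧸ Ideal.span {a, b}) ≠ ⊤)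
    (hs : ∀ r ∈ IsLocalRing.maximalIdeal R, s * r ∈ Ideal.span {a, b})
    (hs0 : s ∉ Ideal.span {a, b})
    (hA : A0 * a + B0 * b + s * c = 0) (hA0 : A0 ∉ Ideal.span {a, b, c}) :
    a ∈ Ideal.span {b, c} := by
  let F : (R × R × R) →ₗ[R] R :=
    (LinearMap.mulRight R a).comp (LinearMap.fst R R (R × R)) +
    (LinearMap.mulRight R b).comp ((LinearMap.fst R R R).comp (LinearMap.snd R R (R × R))) +
    (LinearMap.mulRight R c).comp ((LinearMap.snd R R R).comp (LinearMap.snd R R (R × R)))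
  have hF : ∀ x : R × R × R, F x = x.1 * a + x.2.1 * b + x.2.2 * c := fun x => rfl
  let W := LinearMap.ker F
  set J : Ideal R := Ideal.span {a, b} with hJ
  set I : Ideal R := Ideal.span {a, b, c} with hI
  have hJI : J ≤ I := Ideal.span_mono (by intro x; simp; tauto)
  let ψ : W →ₗ[R] (R ⧸ I) := (Submodule.mkQ I).comp ((LinearMap.fst R R (R × R)).comp W.subtype)
  let χ : W →ₗ[R] (R ⧸ J) :=
    (Submodule.mkQ J).comp (((LinearMap.snd R R R).comp (LinearMap.snd R R (R × R))).comp W.subtype)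
  have hψ : ∀ x : W, x ∈ LinearMap.ker ψ ↔ x.1.1 ∈ I := fun x => by
    rw [LinearMap.mem_ker]; exact Submodule.Quotient.mk_eq_zero I
  have hχ : ∀ x : W, x ∈ LinearMap.ker χ ↔ x.1.2.2 ∈ J := fun x => by
    rw [LinearMap.mem_ker]; exact Submodule.Quotient.mk_eq_zero J
  have hbI : b ∈ I := Ideal.subset_span (by simp)
  have hcI : c ∈ I := Ideal.subset_span (by simp)
  have k1 : LinearMap.ker χ ≤ LinearMap.ker ψ := by
    intro x hx
    rw [hψ]
    rw [hχ, hJ, Ideal.mem_span_pair] at hx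
    obtain ⟨u, v, huv⟩ := hx
    have hxW : F x.1 = 0 := x.2
    rw [hF, ← huv] at hxW
    obtain ⟨t, h1, h2⟩ := hab.syz (u := x.1.1 + u * c) (v := x.1.2.1 + v * c)
      (by linear_combination hxW)
    have : x.1.1 = -t * b - u * c := by linear_combination h1
    rw [this]
    exact I.sub_mem (I.mul_mem_left _ hbI) (I.mul_mem_left _ hcI)
  have k2 : LinearMap.ker ψ ≤ LinearMap.ker χ := by
    intro x hx
    by_contra hx2
    rw [hψ] at hx
    rw [hχ] at hx2
    obtain ⟨r, hr1, hr2⟩ := exists_socle (n := n) hx2 (fun y hy => J.mul_mem_left _ (hn hy))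
    obtain ⟨t, ht⟩ := socle_unique hab hp hm ha hb hr2 hr1 hs
    let w0 : W := ⟨(A0, B0, s), by rw [LinearMap.mem_ker, hF]; exact hA⟩
    have h3 : w0 - (t * r) • x ∈ LinearMap.ker χ := by
      rw [hχ]
      simpa [w0, mul_assoc] using ht
    have h4 := k1 h3
    rw [hψ] at h4
    apply hA0
    have := I.add_mem h4 (I.mul_mem_left (t * r) hx)
    simpa [w0] using this
  have hker : LinearMap.ker ψ = LinearMap.ker χ := le_antisymm k2 k1
  have e1 : Module.length R (LinearMap.range ψ) = Module.length R (LinearMap.range χ) := by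
    rw [← (ψ.quotKerEquivRange).length_eq, ← (χ.quotKerEquivRange).length_eq, hker]
  -- the multiplication by c
  let μ : (R ⧸ J) →ₗ[R] (R ⧸ J) := LinearMap.lsmul R (R ⧸ J) c
  have e2 : LinearMap.range χ = LinearMap.ker μ := by
    ext y
    obtain ⟨y, rfl⟩ := Submodule.mkQ_surjective J y
    constructor
    · rintro ⟨x, hx⟩
      rw [← hx, LinearMap.mem_ker]
      have hxW : F x.1 = 0 := x.2
      rw [hF] at hxW
      change Submodule.mkQ J (c * x.1.2.2) = 0
      refine (Submodule.Quotient.mk_eq_zero J).2 ?_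
      rw [hJ, Ideal.mem_span_pair]
      exact ⟨-x.1.1, -x.1.2.1, by linear_combination -hxW⟩
    · intro hy
      rw [LinearMap.mem_ker] at hy
      have : c * y ∈ J := (Submodule.Quotient.mk_eq_zero J).1 hy
      rw [hJ, Ideal.mem_span_pair] at this
      obtain ⟨u, v, huv⟩ := this
      exact ⟨⟨(-u, -v, y), by rw [LinearMap.mem_ker, hF]; linear_combination -huv⟩, rfl⟩
  let π : (R ⧸ J) →ₗ[R] (R ⧸ I) := Submodule.factor hJI
  have e3 : Module.length R (R ⧸ J) = Module.length R (LinearMap.ker μ) + Module.length R (LinearMap.range μ) :=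
    Module.length_eq_add_of_exact (LinearMap.ker μ).subtype μ.rangeRestrict
      (Submodule.injective_subtype _) μ.surjective_rangeRestrict (by
        rw [LinearMap.exact_iff, LinearMap.ker_rangeRestrict, Submodule.range_subtype])
  have e4 : Module.length R (R ⧸ J) = Module.length R (LinearMap.range μ) + Module.length R (R ⧸ I) :=
    Module.length_eq_add_of_exact (LinearMap.range μ).subtype π
      (Submodule.injective_subtype _) (Submodule.factor_surjective hJI) (by
        rw [LinearMap.exact_iff, Submodule.range_subtype]
        ext y
        obtain ⟨y, rfl⟩ := Submodule.mkQ_surjective J y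
        have : Submodule.mkQ J y ∈ LinearMap.ker π ↔ y ∈ I := by
          rw [LinearMap.mem_ker]; exact Submodule.Quotient.mk_eq_zero I
        rw [this]
        constructor
        · intro hy
          rw [hI, Ideal.mem_span_insert] at hy
          obtain ⟨u, z, hz, hy⟩ := hy
          rw [Ideal.mem_span_pair] at hz
          obtain ⟨v, w, hz⟩ := hz
          refine ⟨Submodule.mkQ J w, ?_⟩
          change Submodule.mkQ J (c * w) = Submodule.mkQ J y
          refine (Submodule.Quotient.eq J).2 ?_
          rw [hJ, Ideal.mem_span_pair]
          exact ⟨-u, -v, by rw [hy, ← hz]; ring⟩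
        · rintro ⟨w, hw⟩
          obtain ⟨w, rfl⟩ := Submodule.mkQ_surjective J w
          have hw' : c * w - y ∈ J := (Submodule.Quotient.eq J).1 hw
          have := I.sub_mem (I.mul_mem_right w hcI) (hJI hw')
          simpa using this)
  have f1 : Module.length R (LinearMap.range μ) ≠ ⊤ := by
    intro h; rw [h] at e4; simp at e4; exact hfin e4
  have f2 : Module.length R (R ⧸ I) ≠ ⊤ := by
    intro h; rw [h] at e4; simp at e4; exact hfin e4
  have e5 : Module.length R (LinearMap.ker μ) = Module.length R (R ⧸ I) := by
    rw [e3, add_comm] at e4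
    exact WithTop.add_left_cancel f1 e4
  have e6 : LinearMap.range ψ = ⊤ := by
    by_contra hne
    have h9 := (isFiniteLength_iff_isNoetherian_isArtinian).1 (Module.length_ne_top_iff.1 f2)
    have := h9.1
    have := h9.2
    have := Submodule.length_lt (R := R) (M := R ⧸ I) (N := LinearMap.range ψ) hne
    rw [e1, e2, e5] at this
    exact lt_irrefl _ this
  have : Submodule.mkQ I 1 ∈ LinearMap.range ψ := by rw [e6]; trivial
  obtain ⟨x, hx⟩ := this
  have hx' : x.1.1 - 1 ∈ I := (Submodule.Quotient.eq I).1 hx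
  have hIm : I ≤ IsLocalRing.maximalIdeal R := by
    rw [hI, Ideal.span_le]; rintro z (rfl | rfl | rfl) <;> assumption
  have hu : IsUnit x.1.1 := by
    by_contra h
    have h1 := (IsLocalRing.mem_maximalIdeal _).2 h
    have h2 := (IsLocalRing.maximalIdeal R).sub_mem h1 (hIm hx')
    simp at h2
  obtain ⟨u, hu⟩ := hu
  have hxW : F x.1 = 0 := x.2
  rw [hF, ← hu] at hxW
  rw [Ideal.mem_span_pair]
  have h1 : (u⁻¹ : Rˣ) * (u : R) = 1 := u.inv_mul
  exact ⟨-↑u⁻¹ * x.1.2.1, -↑u⁻¹ * x.1.2.2, by linear_combination (-↑u⁻¹) * hxW + a * h1⟩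

theorem length_fin {R : Type*} [CommRing R] [IsLocalRing R] [IsNoetherianRing R] {J : Ideal R} {n : ℕ}
    (hn : IsLocalRing.maximalIdeal R ^ n ≤ J) : Module.length R (R ⧸ J) ≠ ⊤ := by
  have : IsArtinianRing (R ⧸ J) := by
    by_cases hJ : J = ⊤
    · have : Subsingleton (R ⧸ J) := Ideal.Quotient.subsingleton_iff.2 hJ
      infer_instance
    have : Nontrivial (R ⧸ J) := Ideal.Quotient.nontrivial_iff.2 hJ
    have : IsLocalRing (R ⧸ J) := IsLocalRing.of_surjective' (Ideal.Quotient.mk J) (Ideal.Quotient.mk_surjective)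
    rw [isArtinianRing_iff_isNilpotent_maximalIdeal]
    refine ⟨n, ?_⟩
    have h : IsLocalRing.maximalIdeal (R ⧸ J) = (IsLocalRing.maximalIdeal R).map (Ideal.Quotient.mk J) := by
      exact (IsLocalRing.map_maximalIdeal_of_surjective _ Ideal.Quotient.mk_surjective).symm
    rw [h, ← Ideal.map_pow]
    exact (Ideal.map_eq_bot_iff_le_ker _).2 (by rwa [Ideal.mk_ker])
  have : IsArtinian R (R ⧸ J) := by
    exact isArtinian_of_surjective_algebraMap (R := R ⧸ J) (S := R) (Ideal.Quotient.mk_surjective (I := J))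
  exact Module.length_ne_top

theorem two_gen {R : Type*} [CommRing R] [IsDomain R] [IsLocalRing R] [IsNoetherianRing R]
    {a b c p q : R} {n : ℕ}
    (hab : RP a b) (hp : RP p q) (hm : IsLocalRing.maximalIdeal R = Ideal.span {p, q})
    (ha : a ∈ IsLocalRing.maximalIdeal R) (hb : b ∈ IsLocalRing.maximalIdeal R)
    (hc : c ∈ IsLocalRing.maximalIdeal R)
    (hn : IsLocalRing.maximalIdeal R ^ n ≤ Ideal.span {a, b})
    (star : ∀ A ∈ Ideal.span {a, b, c}, ∀ B ∈ Ideal.span {a, b, c}, ∀ C ∈ Ideal.span {a, b, c},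
      A * a + B * b + C * c = 0 → C ∈ Ideal.span {a, b}) :
    ∃ x y, Ideal.span {a, b, c} = Ideal.span {x, y} ∧ RP x y := by
  suffices h : ∃ x ∈ IsLocalRing.maximalIdeal R, ∃ y ∈ IsLocalRing.maximalIdeal R,
      Ideal.span {a, b, c} = Ideal.span {x, y} by
    obtain ⟨x, hx, y, hy, h⟩ := h
    refine ⟨x, y, h, hab.of_le ?_ ?_ hx hy⟩
    · rw [← h]; exact Ideal.subset_span (by simp)
    · rw [← h]; exact Ideal.subset_span (by simp)
  have key : ∀ {x y z : R}, x ∈ Ideal.span {y, z} → Ideal.span {x, y, z} = Ideal.span {y, z} := by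
    intro x y z h
    exact Submodule.span_insert_eq_span h
  have hfin := length_fin hn
  by_cases hcJ : c ∈ Ideal.span {a, b}
  · refine ⟨a, ha, b, hb, ?_⟩
    rw [← key hcJ]; congr 1; ext; simp; tauto
  obtain ⟨r, hr1, hr2⟩ := exists_socle (n := n) hcJ (fun y hy => Ideal.mul_mem_left _ _ (hn hy))
  have h0 := hr2 c hc
  rw [Ideal.mem_span_pair] at h0
  obtain ⟨A, B, h0⟩ := h0
  by_cases hA : A ∈ Ideal.span {a, b, c}
  · have hB : B ∉ Ideal.span {b, a, c} := by
      intro hB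
      rw [Set.insert_comm] at hB
      refine hr1 (star (-A) (neg_mem hA) (-B) (neg_mem hB) (r * c) (Ideal.mul_mem_left _ _
        (Ideal.subset_span (by simp))) (by linear_combination -h0))
    have hb0 : b ≠ 0 := by
      rintro rfl
      obtain ⟨t, ht⟩ := hab.2 1 (by simp)
      exact ha (IsUnit.of_mul_eq_one _ ht.symm)
    have := two_gen_aux (hab.symm hb0) hp hm hb ha hc (n := n) (by rwa [Set.pair_comm])
      (by rwa [Set.pair_comm]) (A0 := -B) (B0 := -A) (s := r * c) (by rwa [Set.pair_comm]) (by rwa [Set.pair_comm])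
      (by linear_combination -h0) (by rwa [neg_mem_iff])
    refine ⟨a, ha, c, hc, ?_⟩
    rw [← key this, Set.insert_comm]
  · have := two_gen_aux hab hp hm ha hb hc hn hfin (A0 := -A) (B0 := -B) hr2 hr1
      (by linear_combination -h0) (by rwa [neg_mem_iff])
    exact ⟨b, hb, c, hc, key this⟩

theorem ofList_pair {R : Type*} [CommRing R] (x y : R) :
    Ideal.ofList [x, y] = Ideal.span {x, y} := by
  unfold Ideal.ofList
  congr 1
  ext z
  simp

theorem isRegular_of_RP {R : Type*} [CommRing R] [IsDomain R] [IsLocalRing R] {x y : R}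
    (hx : x ∈ IsLocalRing.maximalIdeal R) (hy : y ∈ IsLocalRing.maximalIdeal R) (h : RP x y) :
    RingTheory.Sequence.IsRegular R [x, y] := by
  have htop : (⊤ : Ideal R) ≠ Ideal.span {x, y} • (⊤ : Submodule R R) := by
    intro h
    rw [smul_eq_mul, Ideal.mul_top] at h
    have : Ideal.span {x, y} ≤ IsLocalRing.maximalIdeal R := by
      rw [Ideal.span_le]; rintro z (rfl | rfl) <;> assumption
    rw [← h, top_le_iff] at this
    exact (Ideal.IsPrime.ne_top inferInstance) this
  refine ⟨?_, ?_⟩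
  · rw [RingTheory.Sequence.isWeaklyRegular_cons_iff, RingTheory.Sequence.isWeaklyRegular_singleton_iff]
    refine ⟨?_, ?_⟩
    · intro u v huv
      exact mul_left_cancel₀ h.1 huv
    · refine (isSMulRegular_quotient_iff_mem_of_smul_mem _ _).2 ?_
      intro v hv
      rw [Submodule.mem_smul_pointwise_iff_exists] at *
      obtain ⟨w, -, hw⟩ := hv
      obtain ⟨t, ht⟩ := h.2 v ⟨w, hw.symm⟩
      exact ⟨t, trivial, ht.symm⟩
  · rwa [ofList_pair]

theorem RP_of_isRegular {R : Type*} [CommRing R] [IsDomain R] [IsLocalRing R] {x y : R}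
    (h : RingTheory.Sequence.IsRegular R [x, y]) : RP x y ∧ ¬ IsUnit x ∧ ¬ IsUnit y := by
  obtain ⟨h1, h2⟩ := h
  rw [RingTheory.Sequence.isWeaklyRegular_cons_iff, RingTheory.Sequence.isWeaklyRegular_singleton_iff] at h1
  obtain ⟨hx, hy⟩ := h1
  have h3 : Ideal.ofList [x, y] = Ideal.span {x, y} := ofList_pair x y
  rw [h3, smul_eq_mul, Ideal.mul_top] at h2
  refine ⟨⟨?_, ?_⟩, ?_, ?_⟩
  · rintro rfl
    exact one_ne_zero (hx (show (0 : R) • (1 : R) = (0 : R) • (0 : R) by simp))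
  · rintro v ⟨w, hw⟩
    have := (isSMulRegular_quotient_iff_mem_of_smul_mem _ _).1 hy v (by
      rw [Submodule.mem_smul_pointwise_iff_exists]
      exact ⟨w, trivial, hw.symm⟩)
    rw [Submodule.mem_smul_pointwise_iff_exists] at this
    obtain ⟨t, -, ht⟩ := this
    exact ⟨t, ht.symm⟩
  · intro hu
    exact h2 (Ideal.eq_top_of_isUnit_mem _ (Ideal.subset_span (by simp)) hu).symm
  · intro hu
    exact h2 (Ideal.eq_top_of_isUnit_mem _ (Ideal.subset_span (by simp)) hu).symm

theorem mem_of_unit {R : Type*} [CommRing R] {a b c u v w : R} (h : u * a + v * b + w * c = 0)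
    (hu : IsUnit u) : a ∈ Ideal.span {b, c} := by
  obtain ⟨u, rfl⟩ := hu
  rw [Ideal.mem_span_pair]
  have h1 : (u⁻¹ : Rˣ) * (u : R) = 1 := u.inv_mul
  exact ⟨-↑u⁻¹ * v, -↑u⁻¹ * w, by linear_combination (-↑u⁻¹) * h + a * h1⟩

theorem two_of_three {R : Type*} [CommRing R] [IsLocalRing R] {a b c x y : R}
    (h : Ideal.span {a, b, c} = Ideal.span {x, y}) :
    a ∈ Ideal.span {b, c} ∨ b ∈ Ideal.span {a, c} ∨ c ∈ Ideal.span {a, b} := by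
  by_contra hcon
  push Not at hcon
  obtain ⟨na, nb, nc⟩ := hcon
  have ha : a ∈ Ideal.span {x, y} := h ▸ Ideal.subset_span (by simp)
  have hb : b ∈ Ideal.span {x, y} := h ▸ Ideal.subset_span (by simp)
  have hc : c ∈ Ideal.span {x, y} := h ▸ Ideal.subset_span (by simp)
  have hx : x ∈ Ideal.span {a, b, c} := h ▸ Ideal.subset_span (by simp)
  have hy : y ∈ Ideal.span {a, b, c} := h ▸ Ideal.subset_span (by simp)
  rw [Ideal.mem_span_pair] at ha hb hc
  rw [Ideal.mem_span_insert] at hx hy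
  obtain ⟨a1, a2, ha⟩ := ha
  obtain ⟨b1, b2, hb⟩ := hb
  obtain ⟨c1, c2, hc⟩ := hc
  obtain ⟨x1, z, hz, hx⟩ := hx
  obtain ⟨y1, z', hz', hy⟩ := hy
  rw [Ideal.mem_span_pair] at hz hz'
  obtain ⟨x2, x3, rfl⟩ := hz
  obtain ⟨y2, y3, rfl⟩ := hz'
  have A1 : ∀ u v w, u * a + v * b + w * c = 0 → IsLocalRing.residue R u = 0 := fun u v w e => by
    rw [IsLocalRing.residue_eq_zero_iff]
    exact fun hu => na (mem_of_unit e hu)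
  have A2 : ∀ u v w, u * a + v * b + w * c = 0 → IsLocalRing.residue R v = 0 := fun u v w e => by
    rw [IsLocalRing.residue_eq_zero_iff]
    exact fun hu => nb (mem_of_unit (v := u) (w := w) (by linear_combination e) hu)
  have A3 : ∀ u v w, u * a + v * b + w * c = 0 → IsLocalRing.residue R w = 0 := fun u v w e => by
    rw [IsLocalRing.residue_eq_zero_iff]
    exact fun hu => nc (mem_of_unit (v := u) (w := v) (by linear_combination e) hu)
  have e1 : (a1 * x1 + a2 * y1 - 1) * a + (a1 * x2 + a2 * y2) * b + (a1 * x3 + a2 * y3) * c = 0 := by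
    linear_combination ha - a1 * hx - a2 * hy
  have e2 : (b1 * x1 + b2 * y1) * a + (b1 * x2 + b2 * y2 - 1) * b + (b1 * x3 + b2 * y3) * c = 0 := by
    linear_combination hb - b1 * hx - b2 * hy
  have e3 : (c1 * x1 + c2 * y1) * a + (c1 * x2 + c2 * y2) * b + (c1 * x3 + c2 * y3 - 1) * c = 0 := by
    linear_combination hc - c1 * hx - c2 * hy
  have r11 := A1 _ _ _ e1
  have r12 := A2 _ _ _ e1
  have r13 := A3 _ _ _ e1
  have r21 := A1 _ _ _ e2
  have r22 := A2 _ _ _ e2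
  have r23 := A3 _ _ _ e2
  have r31 := A1 _ _ _ e3
  have r32 := A2 _ _ _ e3
  have r33 := A3 _ _ _ e3
  rw [map_sub, map_one, sub_eq_zero] at r11 r22 r33
  have key : (a1 * x1 + a2 * y1) * ((b1 * x2 + b2 * y2) * (c1 * x3 + c2 * y3)
        - (b1 * x3 + b2 * y3) * (c1 * x2 + c2 * y2))
      - (a1 * x2 + a2 * y2) * ((b1 * x1 + b2 * y1) * (c1 * x3 + c2 * y3)
        - (b1 * x3 + b2 * y3) * (c1 * x1 + c2 * y1))
      + (a1 * x3 + a2 * y3) * ((b1 * x1 + b2 * y1) * (c1 * x2 + c2 * y2)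
        - (b1 * x2 + b2 * y2) * (c1 * x1 + c2 * y1)) = 0 := by ring
  have key2 := congrArg (IsLocalRing.residue R) key
  rw [map_add, map_sub, map_mul, map_mul, map_mul, map_sub, map_mul, map_mul, r11, r22, r33, r12,
    r13, r23, map_zero] at key2
  simp at key2

theorem local_star {R : Type*} [CommRing R] [IsDomain R] [IsLocalRing R] {a b c x y A B C : R}
    (h : Ideal.span {a, b, c} = Ideal.span {x, y}) (hab : RP a b)
    (ha : ¬ IsUnit a) (hb : ¬ IsUnit b) (hc : ¬ IsUnit c)
    (hA : A ∈ Ideal.span {a, b, c}) (hB : B ∈ Ideal.span {a, b, c})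
    (hC : C ∈ Ideal.span {a, b, c}) (e : A * a + B * b + C * c = 0) :
    C ∈ Ideal.span {a, b} := by
  have main : ∀ {a b A B : R}, RP a b → ¬ IsUnit a → b ∈ Ideal.span {a, c} →
      B ∈ Ideal.span {a, b, c} → A * a + B * b + C * c = 0 → C ∈ Ideal.span {a, b} := by
    intro a b A B hab ha h hB e
    have hac : RP a c := hab.of_le (Ideal.subset_span (by simp)) h ha hc
    rw [Set.insert_comm, span_insert_of_mem h] at hB
    rw [Ideal.mem_span_pair] at h hB ⊢
    obtain ⟨u, v, rfl⟩ := h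
    obtain ⟨b1, b2, rfl⟩ := hB
    obtain ⟨t, h1, h2⟩ := hac.syz (u := A + (b1 * a + b2 * c) * u) (v := (b1 * a + b2 * c) * v + C)
      (by linear_combination e)
    exact ⟨t - b1 * v + b2 * u, -b2, by linear_combination -h2⟩
  rcases two_of_three h with h | h | h
  · have hb0 : b ≠ 0 := by
      rintro rfl
      obtain ⟨t, ht⟩ := hab.2 1 (by simp)
      exact ha (IsUnit.of_mul_eq_one _ ht.symm)
    rw [Set.pair_comm]
    exact main (hab.symm hb0) hb h (by rwa [Set.insert_comm]) (A := B) (B := A) (by linear_combination e)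
  · exact main hab ha h hB e
  · have : Ideal.span {a, b, c} = Ideal.span {a, b} := by
      rw [← span_insert_of_mem h]
      congr 1; ext; simp; tauto
    rwa [this] at hC

theorem poly_monic_reg {A : Type*} [CommRing A] (J : Ideal A) {G t : Polynomial A} (hG : G.Monic)
    (h : G * t ∈ J.map Polynomial.C) : t ∈ J.map Polynomial.C := by
  have hq : ∀ u, u ∈ J.map (Polynomial.C : _ →+* Polynomial A) ↔ u.map (Ideal.Quotient.mk J) = 0 := by
    intro u
    rw [Ideal.mem_map_C_iff, Polynomial.ext_iff]
    simp [Ideal.Quotient.eq_zero_iff_mem]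
  rw [hq] at h ⊢
  rw [Polynomial.map_mul] at h
  exact ((hG.map (Ideal.Quotient.mk J)).mul_right_eq_zero_iff).1 h

open MvPolynomial in
theorem fse_rename {k : Type*} [Field k] {n : ℕ} (u : MvPolynomial (Fin n) k) :
    finSuccEquiv k n (rename Fin.succ u) = Polynomial.C u := by
  induction u using MvPolynomial.induction_on with
  | C a => rw [rename_C, finSuccEquiv_apply]; simp
  | add p q hp hq => rw [map_add, map_add, hp, hq, map_add]
  | mul_X p i hp => rw [map_mul, map_mul, hp, rename_X, finSuccEquiv_X_succ, map_mul]

open MvPolynomial in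
theorem fse_aeval {k : Type*} [Field k] {n : ℕ} (g : Polynomial k) :
    finSuccEquiv k n (Polynomial.aeval (X 0 : MvPolynomial (Fin (n + 1)) k) g) = g.map C := by
  induction g using Polynomial.induction_on' with
  | add p q hp hq => rw [map_add, map_add, hp, hq, Polynomial.map_add]
  | monomial m a =>
    rw [Polynomial.aeval_monomial, map_mul, map_pow, finSuccEquiv_X_zero, Polynomial.map_monomial,
      MvPolynomial.algebraMap_eq, finSuccEquiv_apply]
    simp [Polynomial.C_mul_X_pow_eq_monomial]

theorem map_equiv_aux {A B D : Type*} [CommRing A] [CommRing B] [CommRing D] (r : A →+* B) (e : B ≃+* D)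
    (c : A →+* D) (hc : ∀ u, e (r u) = c u) (J : Ideal A) (u : B) : u ∈ J.map r ↔ e u ∈ J.map c := by
  have : c = (e : B →+* D).comp r := by ext u; exact (hc u).symm
  rw [this, ← Ideal.map_map]
  constructor
  · exact fun h => Ideal.mem_map_of_mem _ h
  · intro h
    obtain ⟨v, hv, hve⟩ := (Ideal.mem_map_iff_of_surjective (e : B →+* D) e.surjective).1 h
    rwa [← e.injective hve]

open MvPolynomial in
theorem monic_reg {k : Type*} [Field k] {n : ℕ} {g : Polynomial k} (hg : g.Monic)
    (J : Ideal (MvPolynomial (Fin n) k)) {t : MvPolynomial (Fin (n + 1)) k}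
    (h : Polynomial.aeval (X 0 : MvPolynomial (Fin (n + 1)) k) g * t ∈ J.map (rename (R := k) (Fin.succ : Fin n → _)).toRingHom) :
    t ∈ J.map (rename (R := k) (Fin.succ : Fin n → _)).toRingHom := by
  have hm := map_equiv_aux (rename (R := k) (Fin.succ : Fin n → _)).toRingHom
    (finSuccEquiv k n).toRingEquiv Polynomial.C fse_rename J
  rw [hm] at h ⊢
  rw [map_mul] at h
  have hG := fse_aeval (n := n) g
  refine poly_monic_reg J (hg.map C) ?_
  rw [← hG]
  exact h

open MvPolynomial in
theorem exists_monic {k : Type*} [Field k] {n : ℕ} (Q : Ideal (MvPolynomial (Fin n) k)) [Q.IsMaximal] (i : Fin n) :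
    ∃ g : Polynomial k, g.Monic ∧ Polynomial.aeval (X i : MvPolynomial (Fin n) k) g ∈ Q := by
  let _ := Ideal.Quotient.field Q
  have : Module.Finite k (MvPolynomial (Fin n) k ⧸ Q) := finite_of_finite_type_of_isJacobsonRing k _
  obtain ⟨g, hg, h⟩ := Algebra.IsIntegral.isIntegral (R := k) (Ideal.Quotient.mk Q (X i))
  refine ⟨g, hg, ?_⟩
  rw [← Ideal.Quotient.eq_zero_iff_mem]
  have := Polynomial.aeval_algHom_apply (Ideal.Quotient.mkₐ k Q) (X i) g
  rw [← Polynomial.aeval_def] at h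
  exact this.symm.trans h

open MvPolynomial in
theorem max_not_assoc {k : Type*} [Field k] (Q : Ideal (MvPolynomial (Fin 3) k)) [Q.IsMaximal]
    {a b s : MvPolynomial (Fin 3) k} (hab : RP a b)
    (h : ∀ r ∈ Q, s * r ∈ Ideal.span {a, b}) : s ∈ Ideal.span {a, b} := by
  obtain ⟨g0, m0, h0⟩ := exists_monic Q 0
  obtain ⟨g1, m1, h1⟩ := exists_monic Q 1
  obtain ⟨g2, m2, h2⟩ := exists_monic Q 2
  have hren : ∀ (n : ℕ) (i : Fin n) (g : Polynomial k),
    (rename (R := k) (Fin.succ : Fin n → _)).toRingHom (Polynomial.aeval (X i) g) = Polynomial.aeval (X i.succ) g := by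
    intro n i g
    have := Polynomial.aeval_algHom_apply (rename (R := k) (Fin.succ : Fin n → _)) (X i) g
    rw [rename_X] at this
    exact this.symm
  have hp : RP (Polynomial.aeval (X 1 : MvPolynomial (Fin 3) k) g1) (Polynomial.aeval (X 2) g2) := by
    have hne : Polynomial.aeval (X 1 : MvPolynomial (Fin 3) k) g1 ≠ 0 := by
      intro h
      exact MvPolynomial.transcendental_X k (1 : Fin 3) ⟨g1, m1.ne_zero, h⟩
    refine ⟨hne, ?_⟩
    intro v hv
    let σ : MvPolynomial (Fin 3) k ≃ₐ[k] MvPolynomial (Fin 3) k := renameEquiv k (Equiv.swap 0 2)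
    have s0 : ∀ (i : Fin 3) (g : Polynomial k), σ (Polynomial.aeval (X i : MvPolynomial (Fin 3) k) g) = Polynomial.aeval (X (Equiv.swap 0 2 i)) g := by
      intro i g
      have := Polynomial.aeval_algHom_apply (rename (R := k) (Equiv.swap (0 : Fin 3) 2)) (X i) g
      rw [rename_X] at this
      exact this.symm
    have s1 : σ (Polynomial.aeval (X 1 : MvPolynomial (Fin 3) k) g1) = Polynomial.aeval (X 1) g1 := s0 1 g1
    have s2 : σ (Polynomial.aeval (X 2 : MvPolynomial (Fin 3) k) g2) = Polynomial.aeval (X 0) g2 := s0 2 g2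
    rw [← map_dvd_iff σ, s1]
    have hv' := map_dvd σ hv
    rw [map_mul, s1, s2] at hv'
    have := monic_reg m2 (Ideal.span {Polynomial.aeval (X 0 : MvPolynomial (Fin 2) k) g1}) (t := σ v)
    rw [Ideal.map_span, Set.image_singleton, hren] at this
    rw [Ideal.mem_span_singleton, Ideal.mem_span_singleton] at this
    exact this hv'
  refine depth_three hab hp (p3 := Polynomial.aeval (X 0) g0) ?_ (h _ h1) (h _ h2) (h _ h0)
  intro t ht
  have := monic_reg m0 (Ideal.span {Polynomial.aeval (X 0 : MvPolynomial (Fin 2) k) g1, Polynomial.aeval (X 1 : MvPolynomial (Fin 2) k) g2}) (t := t)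
  rw [Ideal.map_span, Set.image_pair, hren, hren] at this
  exact this ht

theorem two_le_height {R : Type*} [CommRing R] [IsDomain R] [UniqueFactorizationMonoid R] {a b : R}
    (hab : RP a b) {Q : Ideal R} [hQ : Q.IsPrime] (ha : a ∈ Q) (hb : b ∈ Q) : 2 ≤ Q.height := by
  have : ∃ π ∈ Q, Prime π ∧ π ∣ a := by
    have h := UniqueFactorizationMonoid.factors_prod hab.1
    obtain ⟨u, hu⟩ := h
    have : (UniqueFactorizationMonoid.factors a).prod ∈ Q := by
      have h2 : (UniqueFactorizationMonoid.factors a).prod * u ∈ Q := by rw [hu]; exact ha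
      exact (hQ.mem_or_mem h2).resolve_right (fun h => hQ.ne_top (Ideal.eq_top_of_isUnit_mem _ h u.isUnit))
    obtain ⟨π, h1, h2⟩ := (hQ.multiset_prod_mem_iff_exists_mem _).1 this
    exact ⟨π, h2, UniqueFactorizationMonoid.prime_of_factor _ h1, UniqueFactorizationMonoid.dvd_of_mem_factors h1⟩
  obtain ⟨π, hπQ, hπ, a', ha'⟩ := this
  have hpr : (Ideal.span {π}).IsPrime := (Ideal.span_singleton_prime hπ.ne_zero).2 hπ
  have l1 : (⊥ : Ideal R) < Ideal.span {π} := by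
    rw [bot_lt_iff_ne_bot, Ne, Ideal.span_singleton_eq_bot]; exact hπ.ne_zero
  have l2 : Ideal.span {π} < Q := by
    refine lt_of_le_of_ne ((Ideal.span_singleton_le_iff_mem _).2 hπQ) ?_
    rintro rfl
    obtain ⟨b', hb'⟩ := Ideal.mem_span_singleton.1 hb
    obtain ⟨w, hw⟩ := hab.2 a' ⟨b', by rw [ha', hb']; ring⟩
    apply hπ.not_isUnit
    have ha0 : a' ≠ 0 := by rintro rfl; exact hab.1 (by simpa using ha')
    apply IsUnit.of_mul_eq_one w
    apply mul_left_cancel₀ ha0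
    rw [ha'] at hw
    linear_combination -hw
  have b1 := Ideal.height_add_one_le_of_lt_of_isPrime l1
  have b2 := Ideal.height_add_one_le_of_lt_of_isPrime l2
  have b3 : (1 : ℕ∞) ≤ (Ideal.span {π}).height := le_trans (by simp) b1
  calc (2 : ℕ∞) = 1 + 1 := by norm_num
    _ ≤ (Ideal.span {π}).height + 1 := by gcongr
    _ ≤ _ := b2

theorem RP.localize {S : Type*} [CommRing S] [IsDomain S] {P : Ideal S} [P.IsPrime] {a b : S}
    (h : RP a b) : RP (algebraMap S (Localization.AtPrime P) a) (algebraMap S (Localization.AtPrime P) b) := by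
  have hinj : Function.Injective (algebraMap S (Localization.AtPrime P)) :=
    IsLocalization.injective _ P.primeCompl_le_nonZeroDivisors
  refine ⟨fun h0 => h.1 (hinj (by simpa using h0)), ?_⟩
  rintro v ⟨w, hw⟩
  obtain ⟨⟨v', s⟩, hv⟩ := IsLocalization.surj P.primeCompl v
  obtain ⟨⟨w', t⟩, hw'⟩ := IsLocalization.surj P.primeCompl w
  simp only at hv hw'
  have e : b * (v' * t) = a * (w' * s) := by
    apply hinj
    simp only [map_mul]
    rw [← hv, ← hw']
    linear_combination (algebraMap S (Localization.AtPrime P) s * algebraMap S (Localization.AtPrime P) t) * hw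
  obtain ⟨z, hz⟩ := h.2 _ ⟨_, e⟩
  have hst : IsUnit (algebraMap S (Localization.AtPrime P) (s * t)) :=
    IsLocalization.map_units (M := P.primeCompl) _ (s * t)
  rw [← hst.dvd_mul_right]
  refine ⟨algebraMap S _ z, ?_⟩
  rw [← map_mul, ← hz]
  simp only [map_mul]
  rw [← hv]; ring

theorem pow_le {S : Type*} [CommRing S] [IsDomain S] [IsNoetherianRing S] [UniqueFactorizationMonoid S] {P : Ideal S}
    [hP : P.IsPrime] (hht : P.height = 2) {a b : S}
    (h : RP a b) : ∃ n, IsLocalRing.maximalIdeal (Localization.AtPrime P) ^ n ≤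
      Ideal.span {algebraMap S (Localization.AtPrime P) a, algebraMap S (Localization.AtPrime P) b} := by
  apply Ideal.exists_pow_le_of_le_radical_of_fg _ (IsNoetherian.noetherian _)
  rw [Ideal.radical_eq_sInf]
  refine le_sInf ?_
  rintro Q ⟨hQ1, hQ2⟩
  let q := Q.comap (algebraMap S (Localization.AtPrime P))
  have hq : q.IsPrime := inferInstance
  have ha : a ∈ q := hQ1 (Ideal.subset_span (by simp))
  have hb : b ∈ q := hQ1 (Ideal.subset_span (by simp))
  have h2 := two_le_height h ha hb
  have hQ3 : Q ≤ IsLocalRing.maximalIdeal _ := IsLocalRing.le_maximalIdeal hQ2.ne_top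
  have hqP : q ≤ P := by
    have := Ideal.comap_mono (f := algebraMap S (Localization.AtPrime P)) hQ3
    exact this.trans (IsLocalization.AtPrime.under_maximalIdeal (Localization.AtPrime P) P).le
  have : q = P := by
    by_contra hne
    have := Ideal.height_add_one_le_of_lt_of_isPrime (lt_of_le_of_ne hqP hne)
    rw [hht] at this
    have : (2 : ℕ∞) + 1 ≤ 2 := le_trans (by gcongr) this
    exact absurd this (by decide)
  rw [← Localization.AtPrime.map_eq_maximalIdeal, Ideal.map_le_iff_le_comap]
  exact this.ge

theorem IsRelPrime.toRP {S : Type*} [CommRing S] [IsDomain S] [UniqueFactorizationMonoid S] {a b : S}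
    (ha : a ≠ 0) (h : IsRelPrime a b) : RP a b :=
  ⟨ha, fun _ hv => h.dvd_of_dvd_mul_left hv⟩

theorem reg_gens {k : Type*} [Field k] (P : Ideal (MvPolynomial (Fin 3) k)) [P.IsPrime]
    (h : P.height = 2) : (IsLocalRing.maximalIdeal (Localization.AtPrime P)).spanFinrank = 2 := by
  have hr : IsRegularLocalRing (Localization.AtPrime P) := inferInstance
  have h1 := hr.spanFinrank_maximalIdeal
  rw [IsLocalization.AtPrime.ringKrullDim_eq_height P, h] at h1
  exact_mod_cast h1

theorem max_gens {k : Type*} [Field k] (P : Ideal (MvPolynomial (Fin 3) k)) [P.IsPrime]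
    (h : P.height = 2) : ∃ p q : MvPolynomial (Fin 3) k, RP p q ∧
      IsLocalRing.maximalIdeal (Localization.AtPrime P) =
        Ideal.span {algebraMap _ (Localization.AtPrime P) p, algebraMap _ (Localization.AtPrime P) q} := by
  classical
  have h2 := reg_gens P h
  obtain ⟨s, hs, hs2⟩ := Submodule.FG.exists_span_finset_card_eq_spanFinrank
    (IsNoetherian.noetherian (IsLocalRing.maximalIdeal (Localization.AtPrime P)))
  rw [h2, Finset.card_eq_two] at hs
  obtain ⟨x, y, hxy, rfl⟩ := hs
  obtain ⟨⟨x', s⟩, hx⟩ := IsLocalization.surj P.primeCompl x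
  obtain ⟨⟨y', t⟩, hy⟩ := IsLocalization.surj P.primeCompl y
  simp only at hx hy
  have us : IsUnit (algebraMap _ (Localization.AtPrime P) (s : MvPolynomial (Fin 3) k)) :=
    IsLocalization.map_units (M := P.primeCompl) _ s
  have ut : IsUnit (algebraMap _ (Localization.AtPrime P) (t : MvPolynomial (Fin 3) k)) :=
    IsLocalization.map_units (M := P.primeCompl) _ t
  have hM : IsLocalRing.maximalIdeal (Localization.AtPrime P) =
      Ideal.span {algebraMap _ (Localization.AtPrime P) x', algebraMap _ (Localization.AtPrime P) y'} := by
    rw [← hx, ← hy, Ideal.span_insert, Ideal.span_singleton_mul_right_unit us,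
      Ideal.span_singleton_mul_right_unit ut, ← Ideal.span_insert, ← hs2]
    simp [Ideal.span]
  have one : ∀ z, IsLocalRing.maximalIdeal (Localization.AtPrime P) ≠ Ideal.span {z} := by
    intro z hz
    have := Submodule.spanFinrank_span_le_ncard_of_finite (R := Localization.AtPrime P) (Set.finite_singleton z)
    rw [Set.ncard_singleton] at this
    rw [hz] at h2
    change Submodule.spanFinrank (Submodule.span _ {z}) = 2 at h2
    omega
  have hx0 : x' ≠ 0 := by
    rintro rfl
    apply one (algebraMap _ (Localization.AtPrime P) y')
    rw [hM, map_zero, Ideal.span_insert]; simp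
  obtain ⟨p, q, d, hr, hp, hq⟩ := UniqueFactorizationMonoid.exists_reduced_factors x' hx0 y'
  refine ⟨p, q, hr.toRP (by rintro rfl; exact hx0 (by simp [← hp])), ?_⟩
  have hd : IsUnit (algebraMap _ (Localization.AtPrime P) d) := by
    by_contra hd
    apply one (algebraMap _ (Localization.AtPrime P) d)
    apply le_antisymm
    · rw [hM, Ideal.span_le]
      rintro _ (rfl | rfl)
      · exact Ideal.mem_span_singleton.2 (map_dvd _ ⟨p, hp.symm⟩)
      · exact Ideal.mem_span_singleton.2 (map_dvd _ ⟨q, hq.symm⟩)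
    · rw [Ideal.span_singleton_le_iff_mem]; exact hd
  rw [hM, ← hp, ← hq, map_mul, map_mul, Ideal.span_insert, Ideal.span_singleton_mul_left_unit hd,
      Ideal.span_singleton_mul_left_unit hd, ← Ideal.span_insert]

theorem height_le_two {k : Type*} [Field k] (P : Ideal (MvPolynomial (Fin 3) k)) [hP : P.IsPrime]
    (h : ¬ P.IsMaximal) : P.height ≤ 2 := by
  have hd : ringKrullDim (MvPolynomial (Fin 3) k) = 3 := by
    rw [MvPolynomial.ringKrullDim_of_isNoetherianRing, ringKrullDim_eq_zero_of_field]; simp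
  have : FiniteRingKrullDim (MvPolynomial (Fin 3) k) := by
    rw [finiteRingKrullDim_iff_ne_bot_and_top, hd]
    exact ⟨by decide, by decide⟩
  have h1 := Ideal.height_le_ringKrullDim_of_ne_top hP.ne_top
  have h2 : (P.height : WithBot ℕ∞) ≠ ringKrullDim _ := fun e => h (Ideal.isMaximal_of_height_eq_ringKrullDim e)
  rw [hd] at h1 h2
  have h3 : P.height ≤ 3 := WithBot.coe_le_coe.1 h1
  have h4 : P.height ≠ 3 := fun e => h2 (by rw [e]; rfl)
  have : P.height < 2 + 1 := lt_of_le_of_ne h3 h4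
  exact Order.le_of_lt_add_one this

theorem mem_pair_localize {S : Type*} [CommRing S] [IsDomain S] {P : Ideal S} [P.IsPrime] {J : Ideal S} {c : S}
    (h : algebraMap S (Localization.AtPrime P) c ∈ J.map (algebraMap S (Localization.AtPrime P))) :
    ∃ t ∉ P, c * t ∈ J := by
  rw [IsLocalization.algebraMap_mem_map_algebraMap_iff P.primeCompl] at h
  obtain ⟨t, ht, h⟩ := h
  exact ⟨t, ht, by rwa [mul_comm]⟩
attribute [local instance] MvPolynomial.gradedAlgebra

theorem ht_ge {S : Type*} [CommRing S] {I : Ideal S} (h : idealHeight I = 2) {P : Ideal S} (hP : P.IsPrime)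
    (hIP : I ≤ P) : 2 ≤ P.height := by
  rw [← h]
  have := PrimeSpectrum.height_eq_orderHeight ⟨P, hP⟩
  change P.height = _ at this
  rw [this]
  exact iInf₂_le (⟨P, hP⟩ : PrimeSpectrum S) hIP

theorem ht_ex {S : Type*} [CommRing S] {I : Ideal S} (h : idealHeight I = 2) :
    ∃ P : Ideal S, P.IsPrime ∧ I ≤ P ∧ P.height = 2 := by
  by_contra hc
  push Not at hc
  have h3 : (2 + 1 : ℕ∞) ≤ idealHeight I := by
    refine le_iInf₂ fun P hP => ?_
    rw [← PrimeSpectrum.height_eq_orderHeight]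
    have h1 := ht_ge h P.2 hP
    have h2 := hc _ P.2 hP
    exact Order.add_one_le_of_lt (lt_of_le_of_ne h1 h2.symm)
  rw [h] at h3
  exact absurd h3 (by decide)

theorem min_of_ht {S : Type*} [CommRing S] {I : Ideal S} (h : idealHeight I = 2) {P : Ideal S} (hP : P.IsPrime)
    (hIP : I ≤ P) (h2 : P.height = 2) : P ∈ I.minimalPrimes := by
  refine ⟨⟨hP, hIP⟩, ?_⟩
  rintro Q ⟨hQ, hIQ⟩ hQP
  by_contra hne
  have := Ideal.height_add_one_le_of_lt_of_isPrime (lt_of_le_not_ge hQP hne)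
  rw [h2] at this
  have : (2 : ℕ∞) + 1 ≤ 2 := le_trans (by gcongr; exact ht_ge h hQ hIQ) this
  exact absurd this (by decide)

theorem min_hom {k : Type*} [Field k] {I : Ideal (MvPolynomial (Fin 3) k)}
    (hI : I.IsHomogeneous (homogeneousSubmodule (Fin 3) k)) {P : Ideal (MvPolynomial (Fin 3) k)}
    (hP : P ∈ I.minimalPrimes) : P ≤ RingHom.ker (constantCoeff : MvPolynomial (Fin 3) k →+* k) := by
  have h1 := Ideal.IsPrime.homogeneousCore (𝒜 := homogeneousSubmodule (Fin 3) k) hP.1.1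
  have h2 : I ≤ (P.homogeneousCore (homogeneousSubmodule (Fin 3) k)).toIdeal := by
    rw [← (Ideal.IsHomogeneous.iff_eq (homogeneousSubmodule (Fin 3) k) I).1 hI]
    exact Ideal.homogeneousCore_mono _ hP.1.2
  have h3 := Ideal.toIdeal_homogeneousCore_le (homogeneousSubmodule (Fin 3) k) P
  have h4 := le_antisymm h3 (hP.2 ⟨h1, h2⟩ h3)
  have h5 : P.IsHomogeneous (homogeneousSubmodule (Fin 3) k) := (Ideal.IsHomogeneous.iff_eq (homogeneousSubmodule (Fin 3) k) P).2 h4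
  intro f hf
  have h6 := h5 0 hf
  rw [RingHom.mem_ker]
  by_contra hc
  apply hP.1.1.ne_top
  refine Ideal.eq_top_of_isUnit_mem _ h6 ?_
  have : ((DirectSum.decompose (homogeneousSubmodule (Fin 3) k) f 0 : _) : MvPolynomial (Fin 3) k) = C (constantCoeff f) := by
    refine (MvPolynomial.decomposition.decompose'_apply f 0).trans ?_
    rw [homogeneousComponent_zero]; rfl
  rw [this]
  exact (IsUnit.mk0 _ hc).map C

theorem min_ht {k : Type*} [Field k] {I : Ideal (MvPolynomial (Fin 3) k)}
    (hI : I.IsHomogeneous (homogeneousSubmodule (Fin 3) k)) (h : idealHeight I = 2) {P : Ideal (MvPolynomial (Fin 3) k)}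
    (hP : P ∈ I.minimalPrimes) : P.height = 2 := by
  have hp := hP.1.1
  by_cases hm : P.IsMaximal
  · obtain ⟨P0, hp0, hI0, h0⟩ := ht_ex h
    have hm0 := min_of_ht h hp0 hI0 h0
    have hk : RingHom.ker (constantCoeff : MvPolynomial (Fin 3) k →+* k) ≠ ⊤ := RingHom.ker_ne_top _
    have e := hm.eq_of_le hk (min_hom hI hP)
    have : P0 ≤ P := by rw [e]; exact min_hom hI hm0
    rw [le_antisymm (hP.2 ⟨hp0, hI0⟩ this) this, h0]
  · exact le_antisymm (height_le_two P hm) (ht_ge h hp hP.1.2)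

theorem exists_assoc {S : Type*} [CommRing S] [IsNoetherianRing S] (J : Ideal S) {c : S} (hc : c ∉ J) :
    ∃ Q : Ideal S, Q.IsPrime ∧ (∀ r, c * r ∈ J → r ∈ Q) ∧ ∃ s, s ∉ J ∧ ∀ r ∈ Q, s * r ∈ J := by
  obtain ⟨Q, hQ, hle⟩ := exists_le_isAssociatedPrime_of_isNoetherianRing S (Ideal.Quotient.mk J c)
    (by rwa [Ne, Ideal.Quotient.eq_zero_iff_mem])
  obtain ⟨hQp, x, hx⟩ := isAssociatedPrime_iff.1 hQ
  obtain ⟨s, rfl⟩ := Ideal.Quotient.mk_surjective x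
  have key : ∀ u r : S, r ∈ (⊥ : Submodule S (S ⧸ J)).colon {Ideal.Quotient.mk J u} ↔ u * r ∈ J := by
    intro u r
    rw [Submodule.mem_colon_singleton, Submodule.mem_bot, ← Ideal.Quotient.eq_zero_iff_mem, mul_comm, map_mul]
    rfl
  refine ⟨Q, hQp, fun r hr => hle ((key _ _).2 hr), s, ?_, fun r hr => (key _ _).1 (hx ▸ hr)⟩
  intro hs
  apply hQp.ne_top
  rw [hx, Ideal.eq_top_iff_one, key, mul_one]
  exact hs

/-- the key local condition -/
def StarC {S : Type*} [CommRing S] (T : Set S) (a b c : S) : Prop :=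
  ∀ A ∈ T, ∀ B ∈ T, ∀ C ∈ T, A * a + B * b + C * c = 0 → C ∈ Ideal.span {a, b}

def VK {S : Type*} [CommRing S] (T : Set S) (a b c : S) : Prop :=
  ∀ A ∈ T, ∀ B ∈ T, ∀ C ∈ T, A * a + B * b + C * c = 0 →
    ∃ u v w, A = u * b + v * c ∧ B = -u * a + w * c ∧ C = -v * a - w * b

theorem VK_iff_Star {S : Type*} [CommRing S] [IsDomain S] {T : Set S} {a b c : S} (h : RP a b) :
    VK T a b c ↔ StarC T a b c := by
  constructor
  · intro hv A hA B hB C hC e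
    obtain ⟨u, v, w, -, -, h3⟩ := hv A hA B hB C hC e
    rw [Ideal.mem_span_pair]
    exact ⟨-v, -w, by rw [h3]; ring⟩
  · intro hs A hA B hB C hC e
    obtain ⟨p, q, hC'⟩ := Ideal.mem_span_pair.1 (hs A hA B hB C hC e)
    obtain ⟨t, h1, h2⟩ := h.syz (u := A + p * c) (v := B + q * c) (by linear_combination e + c * hC')
    exact ⟨-t, -p, -q, by linear_combination h1, by linear_combination h2, by linear_combination -hC'⟩

theorem VK.swap12 {S : Type*} [CommRing S] {T : Set S} {a b c : S} (h : VK T a b c) : VK T b a c := by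
  intro A hA B hB C hC e
  obtain ⟨u, v, w, h1, h2, h3⟩ := h B hB A hA C hC (by linear_combination e)
  exact ⟨-u, w, v, by rw [h2], by rw [h1]; ring, by rw [h3]; ring⟩

theorem VK.swap13 {S : Type*} [CommRing S] {T : Set S} {a b c : S} (h : VK T a b c) : VK T c b a := by
  intro A hA B hB C hC e
  obtain ⟨u, v, w, h1, h2, h3⟩ := h C hC B hB A hA (by linear_combination e)
  exact ⟨-w, -v, -u, by rw [h3]; ring, by rw [h2]; ring, by rw [h1]; ring⟩

theorem VK.add {S : Type*} [CommRing S] {J : Set S} {a b c r : S}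
    (hJ : ∀ B ∈ J, ∀ C ∈ J, C + r * B ∈ J)
    (h : VK J a b c) : VK J a (b + r * c) c := by
  intro A hA B hB C hC e
  obtain ⟨u, v, w, h1, h2, h3⟩ := h A hA B hB (C + r * B)
    (hJ B hB C hC) (by linear_combination e)
  exact ⟨u, v - u * r, w, by rw [h1]; ring, by rw [h2], by linear_combination h3 - r * h2⟩

theorem exists_coprime {S : Type*} [CommRing S] [IsDomain S] [UniqueFactorizationMonoid S] {a b c : S} (ha : a ≠ 0)
    (h : ∀ π, Prime π → π ∣ a → π ∣ b → ¬ π ∣ c) : ∃ r, RP a (b + r * c) := by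
  classical
  let F := (UniqueFactorizationMonoid.factors a).filter (fun π => ¬ π ∣ b)
  refine ⟨F.prod, IsRelPrime.toRP ha ?_⟩
  rw [UniqueFactorizationMonoid.isRelPrime_iff_no_prime_factors ha]
  intro d hd1 hd2 hd
  obtain ⟨q, hq, hdq⟩ := UniqueFactorizationMonoid.exists_mem_factors_of_dvd ha hd.irreducible hd1
  have hF : ∀ π ∈ F, Prime π ∧ ¬ π ∣ b := by
    intro π hπ
    have := Multiset.mem_filter.1 hπ
    exact ⟨UniqueFactorizationMonoid.prime_of_factor _ this.1, this.2⟩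
  by_cases hb : d ∣ b
  · have h1 : d ∣ F.prod * c := (dvd_add_right hb).1 hd2
    rcases hd.dvd_or_dvd h1 with h2 | h2
    · obtain ⟨π, hπ, hdπ⟩ := hd.exists_mem_multiset_dvd h2
      have := (hd.associated_of_dvd (hF π hπ).1 hdπ)
      exact (hF π hπ).2 (this.symm.dvd.trans hb)
    · exact h d hd hd1 hb h2
  · have hqF : q ∈ F := Multiset.mem_filter.2 ⟨hq, fun hh => hb (hdq.dvd.trans hh)⟩
    have : d ∣ F.prod * c := (hdq.dvd.trans (Multiset.dvd_prod hqF)).mul_right _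
    exact hb ((dvd_add_left this).1 hd2)

theorem no_common {S : Type*} [CommRing S] [IsDomain S] [IsNoetherianRing S] {I : Ideal S}
    (h : idealHeight I = 2) {π : S} (hπ : Prime π) (hI : I ≤ Ideal.span {π}) : False := by
  have hpr : (Ideal.span {π}).IsPrime := (Ideal.span_singleton_prime hπ.ne_zero).2 hπ
  have h1 := ht_ge h hpr hI
  have h2 := Ideal.height_le_one_of_isPrincipal_of_mem_minimalPrimes (Ideal.span {π}) (Ideal.span {π})
    (by rw [Ideal.minimalPrimes_eq_subsingleton_self]; rfl)
  exact absurd (h1.trans h2) (by decide)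

theorem span3_le {S : Type*} [CommRing S] {a b c : S} {J : Ideal S} :
    Ideal.span {a, b, c} ≤ J ↔ a ∈ J ∧ b ∈ J ∧ c ∈ J := by
  rw [Ideal.span_le]
  simp [Set.insert_subset_iff]

theorem star_imp_lci {k : Type*} [Field k] {a b c : MvPolynomial (Fin 3) k} (hab : RP a b)
    (hs : StarC (Ideal.span {a, b, c} : Set (MvPolynomial (Fin 3) k)) a b c)
    (P : Ideal (MvPolynomial (Fin 3) k)) [P.IsPrime] (hP : Ideal.span {a, b, c} ≤ P) (h2 : P.height = 2) :
    ∃ x y : Localization.AtPrime P,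
        (Ideal.span {a, b, c}).map (algebraMap (MvPolynomial (Fin 3) k) (Localization.AtPrime P)) =
          Ideal.span {x, y} ∧
        RingTheory.Sequence.IsRegular (Localization.AtPrime P) [x, y] := by
  obtain ⟨ha, hb, hc⟩ := span3_le.1 hP
  obtain ⟨n, hn⟩ := pow_le h2 hab
  obtain ⟨p, q, hpq, hm⟩ := max_gens P h2
  have hmem : ∀ u ∈ P, algebraMap _ (Localization.AtPrime P) u ∈ IsLocalRing.maximalIdeal (Localization.AtPrime P) := by
    intro u hu
    rw [← Localization.AtPrime.map_eq_maximalIdeal]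
    exact Ideal.mem_map_of_mem _ hu
  have hmap : (Ideal.span {a, b, c}).map (algebraMap (MvPolynomial (Fin 3) k) (Localization.AtPrime P)) =
      Ideal.span {algebraMap _ (Localization.AtPrime P) a, algebraMap _ (Localization.AtPrime P) b,
        algebraMap _ (Localization.AtPrime P) c} := by
    rw [Ideal.map_span, Set.image_insert_eq, Set.image_pair]
  have hmap2 : (Ideal.span {a, b}).map (algebraMap (MvPolynomial (Fin 3) k) (Localization.AtPrime P)) =
      Ideal.span {algebraMap _ (Localization.AtPrime P) a, algebraMap _ (Localization.AtPrime P) b} := by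
    rw [Ideal.map_span, Set.image_pair]
  have hinj : Function.Injective (algebraMap (MvPolynomial (Fin 3) k) (Localization.AtPrime P)) :=
    IsLocalization.injective _ P.primeCompl_le_nonZeroDivisors
  have clr : ∀ A ∈ (Ideal.span {a, b, c}).map (algebraMap (MvPolynomial (Fin 3) k) (Localization.AtPrime P)),
      ∃ A' ∈ Ideal.span {a, b, c}, ∃ s : P.primeCompl, A * algebraMap _ (Localization.AtPrime P) (s : MvPolynomial (Fin 3) k) = algebraMap _ _ A' := by
    intro A hA
    obtain ⟨⟨A', s⟩, h⟩ := (IsLocalization.mem_map_algebraMap_iff P.primeCompl _).1 hA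
    exact ⟨A', A'.2, s, h⟩
  obtain ⟨x, y, hxy, hr⟩ := two_gen (R := Localization.AtPrime P)
    (a := algebraMap _ (Localization.AtPrime P) a) (b := algebraMap _ (Localization.AtPrime P) b)
    (c := algebraMap _ (Localization.AtPrime P) c) (n := n) hab.localize hpq.localize hm
    (hmem a ha) (hmem b hb) (hmem c hc) hn (by
      rw [← hmap, ← hmap2]
      intro A hA B hB C hC e
      obtain ⟨A', hA', s, eA⟩ := clr A hA
      obtain ⟨B', hB', t, eB⟩ := clr B hB
      obtain ⟨C', hC', u, eC⟩ := clr C hC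
      have key := hs (A' * (t * u)) (Ideal.mul_mem_right _ _ hA') (B' * (s * u)) (Ideal.mul_mem_right _ _ hB')
        (C' * (s * t)) (Ideal.mul_mem_right _ _ hC') (by
          apply hinj
          simp only [map_add, map_mul, map_zero]
          rw [← eA, ← eB, ← eC]
          linear_combination (algebraMap _ (Localization.AtPrime P) (s : MvPolynomial (Fin 3) k) *
            algebraMap _ (Localization.AtPrime P) (t : MvPolynomial (Fin 3) k) *
            algebraMap _ (Localization.AtPrime P) (u : MvPolynomial (Fin 3) k)) * e)
      have key2 := Ideal.mem_map_of_mem (algebraMap _ (Localization.AtPrime P)) key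
      rw [map_mul, ← eC, mul_assoc, ← map_mul] at key2
      have hu : IsUnit (algebraMap _ (Localization.AtPrime P) ((u * (s * t) : P.primeCompl) : MvPolynomial (Fin 3) k)) :=
        IsLocalization.map_units (M := P.primeCompl) _ _
      exact (Ideal.mul_unit_mem_iff_mem _ hu).1 key2)
  have hle : Ideal.span {x, y} ≤ IsLocalRing.maximalIdeal (Localization.AtPrime P) := by
    rw [← hxy, span3_le]
    exact ⟨hmem a ha, hmem b hb, hmem c hc⟩
  exact ⟨x, y, hmap.trans hxy, isRegular_of_RP (hle (Ideal.subset_span (by simp)))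
    (hle (Ideal.subset_span (by simp))) hr⟩

theorem sat_local {k : Type*} [Field k] {I Q : Ideal (MvPolynomial (Fin 3) k)} [hQ : Q.IsPrime]
    {i : Fin 3} (hi : (X i : MvPolynomial (Fin 3) k) ∉ Q) {A : MvPolynomial (Fin 3) k}
    (hA : A ∈ Ideal.sat (Ideal.span {X 0, X 1, X 2}) I) :
    algebraMap _ (Localization.AtPrime Q) A ∈ I.map (algebraMap _ (Localization.AtPrime Q)) := by
  obtain ⟨j, hj⟩ := hA
  rw [IsLocalization.algebraMap_mem_map_algebraMap_iff Q.primeCompl]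
  refine ⟨X i ^ j, fun h => hi (hQ.mem_of_pow_mem _ h), hj _ (Ideal.pow_mem_pow (Ideal.subset_span ?_) _)⟩
  fin_cases i <;> simp

theorem max_m {k : Type*} [Field k] {Q : Ideal (MvPolynomial (Fin 3) k)} [hQ : Q.IsPrime]
    (h : ∀ i, (X i : MvPolynomial (Fin 3) k) ∈ Q) : Q.IsMaximal := by
  have h1 : RingHom.ker (constantCoeff : MvPolynomial (Fin 3) k →+* k) ≤ Q := by
    have key : ∀ f : MvPolynomial (Fin 3) k, f - C (constantCoeff f) ∈ Q := by
      intro f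
      induction f using MvPolynomial.induction_on with
      | C a => simp
      | add p q hp hq =>
        have := Q.add_mem hp hq
        rw [map_add, map_add]
        convert this using 1
        ring
      | mul_X p i hp =>
        rw [map_mul, constantCoeff_X, mul_zero, map_zero, sub_zero]
        exact Q.mul_mem_left _ (h i)
    intro f hf
    have := key f
    rw [RingHom.mem_ker] at hf
    rwa [hf, map_zero, sub_zero] at this
  have h2 : (RingHom.ker (constantCoeff : MvPolynomial (Fin 3) k →+* k)).IsMaximal :=
    RingHom.ker_isMaximal_of_surjective _ (fun c => ⟨C c, by simp⟩)
  rwa [← h2.eq_of_le hQ.ne_top h1]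

theorem lci_imp_star {k : Type*} [Field k] {a b c : MvPolynomial (Fin 3) k} (hab : RP a b)
    {I : Ideal (MvPolynomial (Fin 3) k)} (hI : I = Ideal.span {a, b, c}) (hht : idealHeight I = 2)
    (H : ∀ (P : Ideal (MvPolynomial (Fin 3) k)) (hP : P ∈ I.minimalPrimes),
      letI : P.IsPrime := hP.1.1
      ∃ x y : Localization.AtPrime P,
        I.map (algebraMap (MvPolynomial (Fin 3) k) (Localization.AtPrime P)) =
          Ideal.span {x, y} ∧
        RingTheory.Sequence.IsRegular (Localization.AtPrime P) [x, y]) :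
    StarC (Ideal.sat (Ideal.span {X 0, X 1, X 2}) I) a b c := by
  intro A hA B hB C hC e
  by_contra hn
  obtain ⟨Q, hQ, hle, s, hs, hsQ⟩ := exists_assoc _ hn
  have hnm : ¬ Q.IsMaximal := fun hm => hs (max_not_assoc Q hab hsQ)
  have ha : a ∈ Q := hle _ (Ideal.mul_mem_left _ _ (Ideal.subset_span (by simp)))
  have hb : b ∈ Q := hle _ (Ideal.mul_mem_left _ _ (Ideal.subset_span (by simp)))
  have hc : c ∈ Q := hle _ (by
    rw [Ideal.mem_span_pair]; exact ⟨-A, -B, by linear_combination -e⟩)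
  have hIQ : I ≤ Q := by rw [hI, span3_le]; exact ⟨ha, hb, hc⟩
  have h2 : Q.height = 2 := le_antisymm (height_le_two Q hnm) (ht_ge hht hQ hIQ)
  have hmin := min_of_ht hht hQ hIQ h2
  obtain ⟨x, y, hxy, hreg⟩ := H Q hmin
  obtain ⟨i, hi⟩ : ∃ i, (X i : MvPolynomial (Fin 3) k) ∉ Q := by
    by_contra hcon
    push Not at hcon
    exact hnm (max_m hcon)
  have lA := sat_local hi hA
  have lB := sat_local hi hB
  have lC := sat_local hi hC
  have hmap : I.map (algebraMap (MvPolynomial (Fin 3) k) (Localization.AtPrime Q)) =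
      Ideal.span {algebraMap _ (Localization.AtPrime Q) a, algebraMap _ (Localization.AtPrime Q) b,
        algebraMap _ (Localization.AtPrime Q) c} := by
    rw [hI, Ideal.map_span, Set.image_insert_eq, Set.image_pair]
  have hmap2 : (Ideal.span {a, b}).map (algebraMap (MvPolynomial (Fin 3) k) (Localization.AtPrime Q)) =
      Ideal.span {algebraMap _ (Localization.AtPrime Q) a, algebraMap _ (Localization.AtPrime Q) b} := by
    rw [Ideal.map_span, Set.image_pair]
  have hmem : ∀ u ∈ Q, ¬ IsUnit (algebraMap _ (Localization.AtPrime Q) u) := by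
    intro u hu
    have : algebraMap _ (Localization.AtPrime Q) u ∈ IsLocalRing.maximalIdeal (Localization.AtPrime Q) := by
      rw [← Localization.AtPrime.map_eq_maximalIdeal]
      exact Ideal.mem_map_of_mem _ hu
    exact this
  rw [hmap] at lA lB lC
  have key := local_star (hmap.symm.trans hxy) hab.localize (hmem a ha) (hmem b hb) (hmem c hc) lA lB lC
    (by rw [← map_mul, ← map_mul, ← map_mul, ← map_add, ← map_add, e, map_zero])
  rw [← hmap2] at key
  obtain ⟨t, ht, hCt⟩ := mem_pair_localize key
  exact ht (hle _ hCt)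

def LCI {k : Type*} [Field k] (I : Ideal (MvPolynomial (Fin 3) k)) : Prop :=
  ∀ (P : Ideal (MvPolynomial (Fin 3) k)) (hP : P ∈ I.minimalPrimes),
      letI : P.IsPrime := hP.1.1
      ∃ x y : Localization.AtPrime P,
        I.map (algebraMap (MvPolynomial (Fin 3) k) (Localization.AtPrime P)) =
          Ideal.span {x, y} ∧
        RingTheory.Sequence.IsRegular (Localization.AtPrime P) [x, y]

theorem mem_sat {S : Type*} [CommRing S] {b I : Ideal S} {x : S} (h : x ∈ I) : x ∈ Ideal.sat b I :=
  ⟨0, fun _ _ => I.mul_mem_left _ h⟩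

theorem sat_add {S : Type*} [CommRing S] {b I : Ideal S} (r : S) :
    ∀ B ∈ Ideal.sat b I, ∀ C ∈ Ideal.sat b I, C + r * B ∈ Ideal.sat b I := by
  rintro B ⟨i, hi⟩ C ⟨j, hj⟩
  refine ⟨i + j, fun y hy => ?_⟩
  have h1 := hi y (Ideal.pow_le_pow_right (Nat.le_add_right i j) hy)
  have h2 := hj y (Ideal.pow_le_pow_right (Nat.le_add_left j i) hy)
  have := I.add_mem h2 (I.mul_mem_left r h1)
  convert this using 1
  ring

theorem core {k : Type*} [Field k] {a b c : MvPolynomial (Fin 3) k} (ha : a ≠ 0)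
    {I : Ideal (MvPolynomial (Fin 3) k)} (hI : I = Ideal.span {a, b, c})
    (hhom : I.IsHomogeneous (homogeneousSubmodule (Fin 3) k)) (hht : idealHeight I = 2) :
    VK (Ideal.sat (Ideal.span {X 0, X 1, X 2}) I) a b c ↔ LCI I := by
  obtain ⟨r, hr⟩ := exists_coprime (a := a) (b := b) (c := c) ha (by
    intro π hπ h1 h2 h3
    refine no_common hht hπ ?_
    rw [hI, span3_le]
    exact ⟨Ideal.mem_span_singleton.2 h1, Ideal.mem_span_singleton.2 h2, Ideal.mem_span_singleton.2 h3⟩)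
  have hI' : I = Ideal.span {a, b + r * c, c} := by
    rw [hI]
    apply le_antisymm
    · rw [span3_le]
      refine ⟨Ideal.subset_span (by simp), ?_, Ideal.subset_span (by simp)⟩
      have h1 : b + r * c ∈ Ideal.span {a, b + r * c, c} := Ideal.subset_span (by simp)
      have h2 : c ∈ Ideal.span {a, b + r * c, c} := Ideal.subset_span (by simp)
      have := Ideal.sub_mem _ h1 (Ideal.mul_mem_left _ r h2)
      rwa [add_sub_cancel_right] at this
    · rw [span3_le]
      exact ⟨Ideal.subset_span (by simp), Ideal.add_mem _ (Ideal.subset_span (by simp))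
        (Ideal.mul_mem_left _ _ (Ideal.subset_span (by simp))), Ideal.subset_span (by simp)⟩
  have h1 : VK (Ideal.sat (Ideal.span {X 0, X 1, X 2}) I) a b c ↔
      VK (Ideal.sat (Ideal.span {X 0, X 1, X 2}) I) a (b + r * c) c := by
    constructor
    · exact VK.add (sat_add r)
    · intro h
      have := VK.add (sat_add (-r)) h
      rwa [show b + r * c + -r * c = b by ring] at this
  rw [h1, VK_iff_Star hr]
  constructor
  · intro hs P hP
    have hp : P.IsPrime := hP.1.1
    have h2 := min_ht hhom hht hP
    have := star_imp_lci hr (c := c) (fun A hA B hB C hC e => hs A (mem_sat (hI' ▸ hA)) B (mem_sat (hI' ▸ hB))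
      C (mem_sat (hI' ▸ hC)) e) P (hI' ▸ hP.1.2) h2
    rw [← hI'] at this
    exact this
  · exact lci_imp_star hr hI' hht

theorem core' {k : Type*} [Field k] {a b c : MvPolynomial (Fin 3) k}
    {I : Ideal (MvPolynomial (Fin 3) k)} (hI : I = Ideal.span {a, b, c})
    (hhom : I.IsHomogeneous (homogeneousSubmodule (Fin 3) k)) (hht : idealHeight I = 2) :
    VK (Ideal.sat (Ideal.span {X 0, X 1, X 2}) I) a b c ↔ LCI I := by
  by_cases ha : a = 0
  · by_cases hb : b = 0
    · by_cases hc : c = 0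
      · exfalso
        have h0 := ht_ge hht (P := ⊥) Ideal.isPrime_bot (by rw [hI, span3_le, ha, hb, hc]; simp)
        rw [Ideal.height_bot] at h0
        exact absurd h0 (by decide)
      · rw [← core (a := c) (b := b) (c := a) hc (by rw [hI]; congr 1; aesop) hhom hht]
        exact ⟨VK.swap13, VK.swap13⟩
    · rw [← core (a := b) (b := a) (c := c) hb (by rw [hI, Set.insert_comm]) hhom hht]
      exact ⟨VK.swap12, VK.swap12⟩
  · exact core ha hI hhom hht

theorem lci_iff_koszul_P2
    (k : Type) [Field k]
    (f₁ f₂ f₃ : MvPolynomial (Fin 3) k) (d₁ d₂ d₃ : ℕ)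
    (h₁ : f₁.IsHomogeneous d₁) (h₂ : f₂.IsHomogeneous d₂) (h₃ : f₃.IsHomogeneous d₃)
    (I : Ideal (MvPolynomial (Fin 3) k)) (hI : I = Ideal.span {f₁, f₂, f₃})
    (hht : idealHeight I = 2) :
    -- V = K (as subsets of S³) iff I is a local complete intersection:
    ({ g : Fin 3 → MvPolynomial (Fin 3) k |
        g 0 * f₁ + g 1 * f₂ + g 2 * f₃ = 0 ∧
        ∀ i, g i ∈ Ideal.sat (Ideal.span {X 0, X 1, X 2}) I } =
      ↑(Submodule.span (MvPolynomial (Fin 3) k)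
          {![f₂, -f₁, 0], ![f₃, 0, -f₁], ![0, f₃, -f₂]}))
    ↔
    (∀ (P : Ideal (MvPolynomial (Fin 3) k)) (hP : P ∈ I.minimalPrimes),
      letI : P.IsPrime := hP.1.1
      ∃ x y : Localization.AtPrime P,
        I.map (algebraMap (MvPolynomial (Fin 3) k) (Localization.AtPrime P)) =
          Ideal.span {x, y} ∧
        RingTheory.Sequence.IsRegular (Localization.AtPrime P) [x, y]) := by
  have hhom : I.IsHomogeneous (homogeneousSubmodule (Fin 3) k) := by
    rw [hI]
    apply Ideal.homogeneous_span
    rintro x (rfl | rfl | rfl)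
    · exact ⟨d₁, h₁⟩
    · exact ⟨d₂, h₂⟩
    · exact ⟨d₃, h₃⟩
  refine Iff.trans ?_ (core' hI hhom hht)
  have hf : f₁ ∈ I ∧ f₂ ∈ I ∧ f₃ ∈ I := by rw [← span3_le, hI]
  have hspan : ∀ g : Fin 3 → MvPolynomial (Fin 3) k, g ∈ Submodule.span (MvPolynomial (Fin 3) k)
          {![f₂, -f₁, 0], ![f₃, 0, -f₁], ![0, f₃, -f₂]} ↔
      ∃ u v w, g 0 = u * f₂ + v * f₃ ∧ g 1 = -u * f₁ + w * f₃ ∧ g 2 = -v * f₁ - w * f₂ := by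
    intro g
    rw [Submodule.mem_span_triple]
    constructor
    · rintro ⟨u, v, w, rfl⟩
      refine ⟨u, v, w, ?_, ?_, ?_⟩ <;> simp
      ring
    · rintro ⟨u, v, w, e1, e2, e3⟩
      refine ⟨u, v, w, ?_⟩
      funext i
      fin_cases i
      · simp [e1]
      · simp [e2]
      · simp [e3]; ring
  constructor
  · intro h A hA B hB C hC e
    have : ![A, B, C] ∈ { g : Fin 3 → MvPolynomial (Fin 3) k |
        g 0 * f₁ + g 1 * f₂ + g 2 * f₃ = 0 ∧
        ∀ i, g i ∈ Ideal.sat (Ideal.span {X 0, X 1, X 2}) I } := by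
      refine ⟨e, fun i => ?_⟩
      fin_cases i
      · exact hA
      · exact hB
      · exact hC
    rw [h] at this
    exact (hspan _).1 this
  · intro h
    ext g
    rw [SetLike.mem_coe, hspan]
    constructor
    · rintro ⟨e, hg⟩
      exact h _ (hg 0) _ (hg 1) _ (hg 2) e
    · rintro ⟨u, v, w, e1, e2, e3⟩
      refine ⟨by rw [e1, e2, e3]; ring, fun i => mem_sat ?_⟩
      fin_cases i
      · change g 0 ∈ I
        rw [e1]
        exact I.add_mem (I.mul_mem_left _ hf.2.1) (I.mul_mem_left _ hf.2.2)
      · change g 1 ∈ I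
        rw [e2]
        exact I.add_mem (I.mul_mem_left _ hf.1) (I.mul_mem_left _ hf.2.2)
      · change g 2 ∈ I
        rw [e3]
        exact I.sub_mem (I.mul_mem_left _ hf.1) (I.mul_mem_left _ hf.2.1)

end
end

section
/- Let k be a field, R = k[s,u,t,v] with the bigrading deg s = deg u = (1,0), deg t = deg v = (0,1), and let f1, f2, f3 ∈ R be bihomogeneous of bidegrees (d1,d1'), (d2,d2'), (d3,d3') generating an ideal I of height 2. Then for every pair (k,k') with (k − d1 − d2 − d3 + 1)·(k' − d1' − d2' − d3' + 1) ≥ 0, the bigraded pieces satisfy K_{k,k'} = (K^sat)_{k,k'}, where K is the Koszul module. -/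
/-!
STATEMENT 11: k field, R = k[s,u,t,v] bigraded, f1,f2,f3 bihomogeneous of
bidegrees (d_i, d_i') generating an ideal I of height 2.  For every (k,k')
with (k − d1 − d2 − d3 + 1)(k' − d1' − d2' − d3' + 1) ≥ 0 the bigraded pieces
satisfy K_{k,k'} = (K^sat)_{k,k'}, where K is the Koszul module.

Variables: X 0 = s, X 1 = u, X 2 = t, X 3 = v.
-/

open MvPolynomial

noncomputable section

/-- bidegree weights: s,u ↦ (1,0); t,v ↦ (0,1). -/
def bw : Fin 4 → ℤ × ℤ := ![(1,0), (1,0), (0,1), (0,1)]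

/-- `p` is bihomogeneous of bidegree `(a,b)`. -/
def Bihom {k : Type} [Field k] (p : MvPolynomial (Fin 4) k) (a b : ℤ) : Prop :=
  p.IsWeightedHomogeneous bw (a, b)

/-- The irrelevant ideal ⟨st, sv, ut, uv⟩. -/
def irrel (k : Type) [Field k] : Ideal (MvPolynomial (Fin 4) k) :=
  Ideal.span {X 0 * X 2, X 0 * X 3, X 1 * X 2, X 1 * X 3}

/-- The Koszul module of f₁, f₂, f₃. -/
def Kos {k : Type} [Field k] (f₁ f₂ f₃ : MvPolynomial (Fin 4) k) :
    Submodule (MvPolynomial (Fin 4) k) (Fin 3 → MvPolynomial (Fin 4) k) :=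
  Submodule.span (MvPolynomial (Fin 4) k) {![f₂, -f₁, 0], ![f₃, 0, -f₁], ![0, f₃, -f₂]}

/-- Saturation of a submodule `M` with respect to an ideal `b`: the set of
elements `x` with `b^j • x ⊆ M` for some `j`. -/
def Submodule.satSet {A : Type*} [CommRing A] (b : Ideal A) {N : Type*} [AddCommGroup N]
    [Module A N] (M : Submodule A N) : Set N :=
  { x | ∃ j : ℕ, ∀ y ∈ b ^ j, y • x ∈ M }

section KoszulHelpers

open scoped Matrix

variable {k : Type} [Field k]

lemma comp_mul_bihom (p g : MvPolynomial (Fin 4) k) {n : ℤ × ℤ}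
    (hg : g.IsWeightedHomogeneous bw n) (m l : ℤ × ℤ) (hl : l = m + n) :
    weightedHomogeneousComponent bw l (g * p) = g * weightedHomogeneousComponent bw m p := by
  classical
  subst hl
  let := MvPolynomial.weightedGradedAlgebra k bw
  have h := DirectSum.coe_decompose_mul_add_of_right_mem
    (weightedHomogeneousSubmodule k bw) (a := p) (b := g) (i := m) (j := n) hg
  have e : ∀ (q : MvPolynomial (Fin 4) k) (r : ℤ × ℤ),
      ((DirectSum.decompose (weightedHomogeneousSubmodule k bw) q r :
        weightedHomogeneousSubmodule k bw r) : MvPolynomial (Fin 4) k) =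
      weightedHomogeneousComponent bw r q := fun q r =>
    weightedDecomposition.decompose'_apply k bw q r
  rw [e, e] at h
  rw [mul_comm g p, h, mul_comm]

lemma comp_self {p : MvPolynomial (Fin 4) k} {n : ℤ × ℤ}
    (hp : p.IsWeightedHomogeneous bw n) : weightedHomogeneousComponent bw n p = p :=
  hp.weightedHomogeneousComponent_same

lemma Bihom.sub' {p q : MvPolynomial (Fin 4) k} {a b : ℤ} (hp : Bihom p a b) (hq : Bihom q a b) :
    Bihom (p - q) a b :=
  Submodule.sub_mem (weightedHomogeneousSubmodule k bw (a, b)) hp hq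

lemma Bihom.mul' {p q : MvPolynomial (Fin 4) k} {a b a' b' : ℤ} (hp : Bihom p a b)
    (hq : Bihom q a' b') {a'' b'' : ℤ} (h1 : a'' = a + a') (h2 : b'' = b + b') :
    Bihom (p * q) a'' b'' := by
  subst h1 h2
  exact IsWeightedHomogeneous.mul hp hq

lemma bihom_pow (i : Fin 4) (n : ℕ) :
    Bihom ((X i : MvPolynomial (Fin 4) k) ^ n) (n * (bw i).1) (n * (bw i).2) := by
  have := (isWeightedHomogeneous_X k bw i).pow n
  unfold Bihom
  convert this using 1
  ext <;> simp

/-- Lift homogeneous elements of the Koszul module to homogeneous coefficients. -/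
lemma hom_lift (f : Fin 3 → MvPolynomial (Fin 4) k) (d d' : Fin 3 → ℤ)
    (hf : ∀ i, Bihom (f i) (d i) (d' i)) (p q : ℤ)
    (g x : Fin 3 → MvPolynomial (Fin 4) k)
    (hg : ∀ i, Bihom (g i) (p + d 0 + d 1 + d 2 - d i) (q + d' 0 + d' 1 + d' 2 - d' i))
    (hx : g = f ⨯₃ x) :
    ∃ y, g = f ⨯₃ y ∧ ∀ i, Bihom (y i) (p + d i) (q + d' i) := by
  refine ⟨fun i => weightedHomogeneousComponent bw (p + d i, q + d' i) (x i), ?_, fun i =>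
    weightedHomogeneousComponent_isWeightedHomogeneous _ _⟩
  have key : ∀ i j l, (p + d 0 + d 1 + d 2 - d i = p + d l + d j) →
      (q + d' 0 + d' 1 + d' 2 - d' i = q + d' l + d' j) →
      weightedHomogeneousComponent bw
        (p + d 0 + d 1 + d 2 - d i, q + d' 0 + d' 1 + d' 2 - d' i) (f j * x l) =
      f j * weightedHomogeneousComponent bw (p + d l, q + d' l) (x l) := by
    intro i j l h1 h2
    exact comp_mul_bihom _ _ (hf j) _ _ (by ext <;> simp [h1, h2])
  have h : ∀ i, g i = weightedHomogeneousComponent bw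
        (p + d 0 + d 1 + d 2 - d i, q + d' 0 + d' 1 + d' 2 - d' i) ((f ⨯₃ x) i) := by
    intro i
    rw [← hx]
    exact (comp_self (hg i)).symm
  funext i
  rw [h i]
  fin_cases i
  · simp only [cross_apply, Fin.zero_eta, Matrix.cons_val_zero, map_sub]
    rw [key 0 1 2 (by ring) (by ring), key 0 2 1 (by ring) (by ring)]
  · simp only [cross_apply, Fin.mk_one, Matrix.cons_val_one, Matrix.cons_val_zero, map_sub]
    rw [key 1 2 0 (by ring) (by ring), key 1 0 2 (by ring) (by ring)]
  · simp only [cross_apply, Fin.reduceFinMk, Matrix.cons_val, map_sub]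
    rw [key 2 0 1 (by ring) (by ring), key 2 1 0 (by ring) (by ring)]

lemma mem_kos_iff (f g : Fin 3 → MvPolynomial (Fin 4) k) :
    g ∈ Kos (f 0) (f 1) (f 2) ↔ ∃ x, g = f ⨯₃ x := by
  unfold Kos
  rw [Submodule.mem_span_triple]
  constructor
  · rintro ⟨a, b, c, rfl⟩
    refine ⟨![c, -b, a], ?_⟩
    funext i
    fin_cases i <;> simp [cross_apply] <;> ring
  · rintro ⟨x, rfl⟩
    refine ⟨x 2, - x 1, x 0, ?_⟩
    funext i
    fin_cases i <;> simp [cross_apply] <;> ring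

/-- Exactness of the Koszul complex at the second spot. -/
lemma cross_exact (f : Fin 3 → MvPolynomial (Fin 4) k)
    (hht : idealHeight (Ideal.span {f 0, f 1, f 2}) = 2)
    (x : Fin 3 → MvPolynomial (Fin 4) k) (hx : f ⨯₃ x = 0) : ∃ c : MvPolynomial (Fin 4) k, x = c • f := by
  classical
  let : GCDMonoid (MvPolynomial (Fin 4) k) := UniqueFactorizationMonoid.toGCDMonoid _
  have hprim : ∀ z : MvPolynomial (Fin 4) k, (∀ i, z ∣ f i) → IsUnit z := by
    intro z hz
    by_contra hu
    obtain ⟨P, hP⟩ := Ideal.nonempty_minimalPrimes (I := Ideal.span {z})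
      (by rwa [Ne, Ideal.span_singleton_eq_top])
    have h1 := Ideal.height_le_one_of_isPrincipal_of_mem_minimalPrimes (Ideal.span {z}) P hP
    have hPp : P.IsPrime := hP.1.1
    have h2 : idealHeight (Ideal.span {f 0, f 1, f 2}) ≤ Order.height (⟨P, hPp⟩ : PrimeSpectrum _) := by
      refine iInf₂_le _ ?_
      refine le_trans ?_ hP.1.2
      rw [Ideal.span_le]
      rintro y (rfl | rfl | rfl) <;> exact Ideal.mem_span_singleton.2 (hz _)
    have h3 := PrimeSpectrum.height_eq_orderHeight (⟨P, hPp⟩ : PrimeSpectrum _)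
    rw [← h3] at h2
    rw [hht] at h2
    have := h2.trans h1
    norm_num at this
  have e : ∀ i j, f i * x j = f j * x i := by
    have e0 := congrFun hx 0
    have e1 := congrFun hx 1
    have e2 := congrFun hx 2
    simp [cross_apply, sub_eq_zero] at e0 e1 e2
    intro i j
    fin_cases i <;> fin_cases j <;> simp [e0, e1, e2]
  have hgcd : IsUnit (gcd (f 0) (gcd (f 1) (f 2))) := by
    apply hprim
    intro i
    fin_cases i
    · exact gcd_dvd_left _ _
    · exact (gcd_dvd_right _ _).trans (gcd_dvd_left _ _)
    · exact (gcd_dvd_right _ _).trans (gcd_dvd_right _ _)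
  obtain ⟨i, hi⟩ : ∃ i, f i ≠ 0 := by
    by_contra! h
    have := hprim 0 (fun i => by simp [h i])
    simp at this
  have hd : f i ∣ x i := by
    have h1 : ∀ j, f i ∣ x i * f j := fun j => ⟨x j, by rw [mul_comm, ← e i j]⟩
    have h2 : f i ∣ gcd (x i * f 0) (x i * gcd (f 1) (f 2)) := by
      refine dvd_gcd (h1 0) ?_
      exact (dvd_gcd (h1 1) (h1 2)).trans (gcd_mul_left' _ _ _).dvd
    exact (hgcd.dvd_mul_right).1 (h2.trans (gcd_mul_left' _ _ _).dvd)
  obtain ⟨c, hc⟩ := hd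
  refine ⟨c, funext fun j => mul_left_cancel₀ hi ?_⟩
  rw [e i j, hc, Pi.smul_apply, smul_eq_mul]
  ring

lemma cross_exact_hom (f : Fin 3 → MvPolynomial (Fin 4) k) (d d' : Fin 3 → ℤ)
    (hf : ∀ i, Bihom (f i) (d i) (d' i))
    (hht : idealHeight (Ideal.span {f 0, f 1, f 2}) = 2) (p q : ℤ)
    (x : Fin 3 → MvPolynomial (Fin 4) k) (hx : f ⨯₃ x = 0)
    (hxd : ∀ i, Bihom (x i) (p + d i) (q + d' i)) : ∃ c : MvPolynomial (Fin 4) k, x = c • f ∧ Bihom c p q := by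
  obtain ⟨c, hc⟩ := cross_exact f hht x hx
  refine ⟨weightedHomogeneousComponent bw (p, q) c, funext fun i => ?_,
    weightedHomogeneousComponent_isWeightedHomogeneous _ _⟩
  rw [← comp_self (hxd i), hc, Pi.smul_apply, Pi.smul_apply, smul_eq_mul, smul_eq_mul, mul_comm,
    comp_mul_bihom c (f i) (hf i) (p, q) (p + d i, q + d' i) rfl, mul_comm]

lemma bihom_support {c : MvPolynomial (Fin 4) k} {p q : ℤ} (hc : Bihom c p q)
    {m : Fin 4 →₀ ℕ} (hm : m ∈ c.support) :
    (m 0 : ℤ) + m 1 = p ∧ (m 2 : ℤ) + m 3 = q := by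
  have h := hc (mem_support_iff.1 hm)
  rw [Finsupp.weight_apply, Finsupp.sum_fintype _ _ (by simp)] at h
  have h1 := congrArg Prod.fst h
  have h2 := congrArg Prod.snd h
  simp [Fin.sum_univ_four, bw, -nsmul_eq_mul] at h1 h2
  exact ⟨by simpa using h1, by simpa using h2⟩

lemma mem_span_pow (c : MvPolynomial (Fin 4) k) (i j : Fin 4) (N : ℕ) :
    c ∈ Ideal.span {(X i : MvPolynomial (Fin 4) k) ^ N, X j ^ N} ↔
      ∀ m ∈ c.support, N ≤ m i ∨ N ≤ m j := by
  have : ({(X i : MvPolynomial (Fin 4) k) ^ N, X j ^ N} : Set (MvPolynomial (Fin 4) k)) =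
      (fun s => monomial s (1 : k)) '' {Finsupp.single i N, Finsupp.single j N} := by
    rw [Set.image_pair, X_pow_eq_monomial, X_pow_eq_monomial]
  rw [this, mem_ideal_span_monomial_image]
  simp

lemma mem_span_of_diff (c c' : MvPolynomial (Fin 4) k) (i j : Fin 4) (hij : i ≠ j) (N : ℕ)
    (hj2 : j ≠ 2) (hj3 : j ≠ 3) (hc : ∀ m ∈ c.support, m i < N)
    (h : X j ^ N * c - X i ^ N * c' ∈ Ideal.span {(X 2 : MvPolynomial (Fin 4) k) ^ N, X 3 ^ N}) :
    c ∈ Ideal.span {(X 2 : MvPolynomial (Fin 4) k) ^ N, X 3 ^ N} := by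
  classical
  rw [mem_span_pow] at h ⊢
  intro m hm
  have := h (m + Finsupp.single j N) ?_
  · simpa [hj2, hj3, Finsupp.single_apply] using this
  · rw [mem_support_iff, coeff_sub, X_pow_eq_monomial, X_pow_eq_monomial, coeff_monomial_mul',
      coeff_monomial_mul', if_pos (by simp), if_neg]
    · simpa using hm
    · have := hc m hm
      simp [hij.symm]
      exact this

lemma pow_dvd_cancel {i j : Fin 4} (hij : i ≠ j) (N : ℕ) (y : MvPolynomial (Fin 4) k)
    (h : (X i : MvPolynomial (Fin 4) k) ^ N ∣ X j ^ N * y) : X i ^ N ∣ y := by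
  have hp : Prime (X i : MvPolynomial (Fin 4) k) := X_prime
  refine hp.pow_dvd_of_dvd_mul_left N (fun h' => ?_) h
  have := hp.dvd_of_dvd_pow h'
  exact hij (by simpa [X_dvd_X] using this)

/-- The division step. -/
lemma division_step (f g x y : Fin 3 → MvPolynomial (Fin 4) k) {i j : Fin 4} (hij : i ≠ j) (N : ℕ)
    (c : MvPolynomial (Fin 4) k)
    (hx : (X i : MvPolynomial (Fin 4) k) ^ N • g = f ⨯₃ x)
    (hc : (X j : MvPolynomial (Fin 4) k) ^ N • x - (X i : MvPolynomial (Fin 4) k) ^ N • y = c • f)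
    (hm : c ∈ Ideal.span {(X i : MvPolynomial (Fin 4) k) ^ N, X j ^ N}) :
    ∃ z, g = f ⨯₃ z := by
  obtain ⟨β, α, rfl⟩ := Ideal.mem_span_pair.1 hm
  have hd : ∀ l, (X i : MvPolynomial (Fin 4) k) ^ N ∣ x l - α * f l := by
    intro l
    apply pow_dvd_cancel hij
    refine ⟨y l + β * f l, ?_⟩
    have := congrFun hc l
    simp only [Pi.sub_apply, Pi.smul_apply, smul_eq_mul] at this
    linear_combination this
  choose z hz using hd
  refine ⟨z, ?_⟩
  have hne : (X i : MvPolynomial (Fin 4) k) ^ N ≠ 0 := pow_ne_zero _ (X_ne_zero i)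
  apply smul_right_injective _ hne
  have hxz : x = α • f + (X i : MvPolynomial (Fin 4) k) ^ N • z := by
    funext l
    have := hz l
    simp only [Pi.add_apply, Pi.smul_apply, smul_eq_mul]
    linear_combination this
  simp only
  rw [hx, hxz, map_add, map_smul, map_smul, cross_self, smul_zero, zero_add]

/-- Four local lifts glue, away from the second factor. -/
lemma kos_core (f : Fin 3 → MvPolynomial (Fin 4) k) (d d' : Fin 3 → ℤ)
    (hf : ∀ i, Bihom (f i) (d i) (d' i))
    (hht : idealHeight (Ideal.span {f 0, f 1, f 2}) = 2) (p q : ℤ)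
    (hpq : (-1 ≤ p ∧ -1 ≤ q) ∨ (p ≤ -1 ∧ q ≤ -1))
    (g : Fin 3 → MvPolynomial (Fin 4) k)
    (hg : ∀ i, Bihom (g i) (p + d 0 + d 1 + d 2 - d i) (q + d' 0 + d' 1 + d' 2 - d' i))
    (N : ℕ)
    (H : ∀ i j : Fin 4, (i = 0 ∨ i = 1) → (j = 2 ∨ j = 3) →
      ∃ x, ((X i : MvPolynomial (Fin 4) k) ^ N * X j ^ N) • g = f ⨯₃ x) :
    ∃ z, g = f ⨯₃ z := by
  have B0 : ∀ i : Fin 4, (i = 0 ∨ i = 1) → Bihom ((X i : MvPolynomial (Fin 4) k) ^ N) N 0 := by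
    intro i hi
    have := bihom_pow (k := k) i N
    rcases hi with rfl | rfl <;> simpa [bw] using this
  have B1 : ∀ i : Fin 4, (i = 2 ∨ i = 3) → Bihom ((X i : MvPolynomial (Fin 4) k) ^ N) 0 N := by
    intro i hi
    have := bihom_pow (k := k) i N
    rcases hi with rfl | rfl <;> simpa [bw] using this
  have H' : ∀ i j : Fin 4, (i = 0 ∨ i = 1) → (j = 2 ∨ j = 3) →
      ∃ x, ((X i : MvPolynomial (Fin 4) k) ^ N * X j ^ N) • g = f ⨯₃ x ∧
        ∀ l, Bihom (x l) (p + N + d l) (q + N + d' l) := by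
    intro i j hi hj
    obtain ⟨x, hx⟩ := H i j hi hj
    refine hom_lift f d d' hf (p + N) (q + N) _ x (fun l => ?_) hx
    refine Bihom.mul' ((B0 i hi).mul' (B1 j hj) rfl rfl) (hg l) ?_ ?_ <;> ring
  -- the cocycle for fixed `i`
  have C : ∀ i : Fin 4, (i = 0 ∨ i = 1) → ∀ x y : Fin 3 → MvPolynomial (Fin 4) k,
      ((X i : MvPolynomial (Fin 4) k) ^ N * X 2 ^ N) • g = f ⨯₃ x →
      ((X i : MvPolynomial (Fin 4) k) ^ N * X 3 ^ N) • g = f ⨯₃ y →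
      (∀ l, Bihom (x l) (p + N + d l) (q + N + d' l)) →
      (∀ l, Bihom (y l) (p + N + d l) (q + N + d' l)) →
      ∃ c : MvPolynomial (Fin 4) k, (X 3 : MvPolynomial (Fin 4) k) ^ N • x - (X 2 : MvPolynomial (Fin 4) k) ^ N • y = c • f
        ∧ Bihom c (p + N) (q + 2 * N) := by
    intro i hi x y hx hy hxd hyd
    refine cross_exact_hom f d d' hf hht _ _ _ ?_ ?_
    · rw [map_sub, map_smul, map_smul, ← hx, ← hy, smul_smul, smul_smul, sub_eq_zero]
      congr 1
      ring
    · intro l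
      exact Bihom.sub' ((B1 3 (by simp)).mul' (hxd l) (by ring) (by ring))
        ((B1 2 (by simp)).mul' (hyd l) (by ring) (by ring))
  obtain ⟨x1, hx1, hd1⟩ := H' 0 2 (by simp) (by simp)
  obtain ⟨x2, hx2, hd2⟩ := H' 0 3 (by simp) (by simp)
  obtain ⟨x3, hx3, hd3⟩ := H' 1 2 (by simp) (by simp)
  obtain ⟨x4, hx4, hd4⟩ := H' 1 3 (by simp) (by simp)
  obtain ⟨c, hc, hcd⟩ := C 0 (by simp) x1 x2 hx1 hx2 hd1 hd2
  obtain ⟨c', hc', hcd'⟩ := C 1 (by simp) x3 x4 hx3 hx4 hd3 hd4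
  have hmem : c ∈ Ideal.span {(X 2 : MvPolynomial (Fin 4) k) ^ N, X 3 ^ N} ∧
      c' ∈ Ideal.span {(X 2 : MvPolynomial (Fin 4) k) ^ N, X 3 ^ N} := by
    rcases hpq with ⟨-, hq⟩ | ⟨hp, -⟩
    · constructor
      · rw [mem_span_pow]
        intro m hm
        have := bihom_support hcd hm
        omega
      · rw [mem_span_pow]
        intro m hm
        have := bihom_support hcd' hm
        omega
    · obtain ⟨e, he⟩ := cross_exact f hht
        ((X 1 : MvPolynomial (Fin 4) k) ^ N • x1 - (X 0 : MvPolynomial (Fin 4) k) ^ N • x3) (by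
          rw [map_sub, map_smul, map_smul, ← hx1, ← hx3, smul_smul, smul_smul, sub_eq_zero]
          congr 1
          ring)
      obtain ⟨e', he'⟩ := cross_exact f hht
        ((X 1 : MvPolynomial (Fin 4) k) ^ N • x2 - (X 0 : MvPolynomial (Fin 4) k) ^ N • x4) (by
          rw [map_sub, map_smul, map_smul, ← hx2, ← hx4, smul_smul, smul_smul, sub_eq_zero]
          congr 1
          ring)
      obtain ⟨i, hi⟩ : ∃ i, f i ≠ 0 := by
        by_contra! h
        obtain ⟨c0, h0⟩ := cross_exact f hht (fun _ => 1) (by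
          rw [show f = 0 from funext h]; simp)
        have := congrFun h0 0
        simp [h] at this
      have hrel : (X 1 : MvPolynomial (Fin 4) k) ^ N * c - X 0 ^ N * c' =
          (-e') * X 2 ^ N + e * X 3 ^ N := by
        apply mul_right_cancel₀ hi
        have a1 := congrFun hc i
        have a2 := congrFun hc' i
        have a3 := congrFun he i
        have a4 := congrFun he' i
        simp only [Pi.sub_apply, Pi.smul_apply, smul_eq_mul] at a1 a2 a3 a4
        linear_combination (-(X 1 : MvPolynomial (Fin 4) k) ^ N) * a1 + X 0 ^ N * a2
          + X 3 ^ N * a3 - X 2 ^ N * a4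
      have hI : (X 1 : MvPolynomial (Fin 4) k) ^ N * c - X 0 ^ N * c' ∈
          Ideal.span {(X 2 : MvPolynomial (Fin 4) k) ^ N, X 3 ^ N} :=
        Ideal.mem_span_pair.2 ⟨_, _, hrel.symm⟩
      constructor
      · refine mem_span_of_diff c c' 0 1 (by decide) N (by decide) (by decide) ?_ hI
        intro m hm
        have := bihom_support hcd hm
        omega
      · refine mem_span_of_diff c' c 1 0 (by decide) N (by decide) (by decide) ?_ ?_
        · intro m hm
          have := bihom_support hcd' hm
          omega
        · have := Ideal.neg_mem_iff _ |>.2 hI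
          rwa [neg_sub] at this
  obtain ⟨y0, hy0⟩ := division_step f ((X 0 : MvPolynomial (Fin 4) k) ^ N • g) x1 x2
    (i := 2) (j := 3) (by decide) N c (by rw [smul_smul, mul_comm, hx1]) hc hmem.1
  obtain ⟨y1, hy1⟩ := division_step f ((X 1 : MvPolynomial (Fin 4) k) ^ N • g) x3 x4
    (i := 2) (j := 3) (by decide) N c' (by rw [smul_smul, mul_comm, hx3]) hc' hmem.2
  obtain ⟨z0, hz0, hzd0⟩ := hom_lift f d d' hf (p + N) q
    ((X 0 : MvPolynomial (Fin 4) k) ^ N • g) y0 (fun l =>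
    (B0 0 (by simp)).mul' (hg l) (by ring) (by ring)) hy0
  obtain ⟨z1, hz1, hzd1⟩ := hom_lift f d d' hf (p + N) q
    ((X 1 : MvPolynomial (Fin 4) k) ^ N • g) y1 (fun l =>
    (B0 1 (by simp)).mul' (hg l) (by ring) (by ring)) hy1
  obtain ⟨e, he, hed⟩ := cross_exact_hom f d d' hf hht (p + 2 * N) q
    ((X 1 : MvPolynomial (Fin 4) k) ^ N • z0 - (X 0 : MvPolynomial (Fin 4) k) ^ N • z1) (by
      rw [map_sub, map_smul, map_smul, ← hz0, ← hz1, smul_smul, smul_smul, sub_eq_zero]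
      congr 1
      ring) (fun l => Bihom.sub' ((B0 1 (by simp)).mul' (hzd0 l) (by ring) (by ring))
        ((B0 0 (by simp)).mul' (hzd1 l) (by ring) (by ring)))
  refine division_step f g z0 z1 (i := 0) (j := 1) (by decide) N e hz0 he ?_
  rw [mem_span_pow]
  intro m hm
  have := bihom_support hed hm
  omega

end KoszulHelpers

theorem koszul_pieces_saturated_in_region
    (k : Type) [Field k]
    (f : Fin 3 → MvPolynomial (Fin 4) k) (d d' : Fin 3 → ℤ)
    (hf : ∀ i, Bihom (f i) (d i) (d' i))
    (I : Ideal (MvPolynomial (Fin 4) k)) (hI : I = Ideal.span {f 0, f 1, f 2})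
    (hht : idealHeight I = 2) :
    ∀ a b : ℤ,
      (a - d 0 - d 1 - d 2 + 1) * (b - d' 0 - d' 1 - d' 2 + 1) ≥ 0 →
      { g : Fin 3 → MvPolynomial (Fin 4) k |
          g ∈ Kos (f 0) (f 1) (f 2) ∧ ∀ i, Bihom (g i) (a - d i) (b - d' i) } =
      { g : Fin 3 → MvPolynomial (Fin 4) k |
          g ∈ Submodule.satSet (irrel k) (Kos (f 0) (f 1) (f 2)) ∧
          ∀ i, Bihom (g i) (a - d i) (b - d' i) } := by
  intro a b hab
  subst hI
  ext g
  simp only [Set.mem_ofPred_eq]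
  constructor
  · rintro ⟨hg, hd⟩
    exact ⟨⟨0, fun y _ => Submodule.smul_mem _ _ hg⟩, hd⟩
  · rintro ⟨⟨N, hN⟩, hd⟩
    refine ⟨?_, hd⟩
    rw [mem_kos_iff]
    refine kos_core f d d' hf hht (a - d 0 - d 1 - d 2) (b - d' 0 - d' 1 - d' 2) ?_ g ?_ N ?_
    · rcases mul_nonneg_iff.1 hab with h | h
      · left; omega
      · right; omega
    · intro i
      have := hd i
      ring_nf at this ⊢
      exact this
    · intro i j hi hj
      rw [← mem_kos_iff, ← mul_pow]
      apply hN
      apply Ideal.pow_mem_pow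
      apply Ideal.subset_span
      rcases hi with rfl | rfl <;> rcases hj with rfl | rfl <;> simp

end
end
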